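/- Let k and s be natural numbers with k ≥ 2 and 1 ≤ s ≤ (k+1)²/4. Then for every ε > 0 there is a constant C(s,k,ε) such that for all real X ≥ 1 one has J_{s,k}(X) ≤ C(s,k,ε) · X^{s+ε}. -/

import Mathlib

/-- `J s k X` counts the 2s-tuples of integers `(x₁,…,x_s,y₁,…,y_s)` with
`1 ≤ xᵢ, yᵢ ≤ X` satisfying `x₁^j + … + x_s^j = y₁^j + … + y_s^j` for `1 ≤ j ≤ k`. -/
noncomputable def J (s k : ℕ) (X : ℝ) : ℕ :=
  Set.ncard {p : (Fin s → ℤ) × (Fin s → ℤ) |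
    (∀ i, 1 ≤ p.1 i ∧ (p.1 i : ℝ) ≤ X) ∧ (∀ i, 1 ≤ p.2 i ∧ (p.2 i : ℝ) ≤ X) ∧
    ∀ j ∈ Finset.Icc 1 k, ∑ i, p.1 i ^ j = ∑ i, p.2 i ^ j}


open Finset in
lemma fw_esymm_eq {R : Type*} [CommRing R] {r : ℕ} (hu : ∀ l : ℕ, 1 ≤ l → l ≤ r → IsUnit (l : R))
    (w z : Fin r → R) (h : ∀ l : ℕ, 1 ≤ l → l ≤ r → ∑ i, w i ^ l = ∑ i, z i ^ l) (n : ℕ) (hn : n ≤ r) :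
    MvPolynomial.aeval w (MvPolynomial.esymm (Fin r) R n) =
      MvPolynomial.aeval z (MvPolynomial.esymm (Fin r) R n) := by
  induction n using Nat.strong_induction_on with
  | _ n ih =>
    rcases Nat.eq_zero_or_pos n with rfl | hpos
    · simp
    · have key := MvPolynomial.mul_esymm_eq_sum (Fin r) R n
      have h1 := congrArg (MvPolynomial.aeval w) key
      have h2 := congrArg (MvPolynomial.aeval z) key
      apply (hu n hpos hn).mul_left_cancel
      simp only [map_mul, map_natCast, map_sum, map_pow, map_neg, map_one] at h1 h2
      rw [h1, h2]
      congr 1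
      apply Finset.sum_congr rfl
      intro a ha
      simp only [Finset.mem_filter, Finset.HasAntidiagonal.mem_antidiagonal] at ha
      rw [ih a.1 ha.2 (by omega)]
      congr 1
      simp only [MvPolynomial.psum, map_sum, map_pow, MvPolynomial.aeval_X]
      exact h _ (by omega) (by omega)

open Polynomial in
lemma fw_prod_eq {R : Type*} [CommRing R] {r : ℕ} (hu : ∀ l : ℕ, 1 ≤ l → l ≤ r → IsUnit (l : R))
    (w z : Fin r → R) (h : ∀ l : ℕ, 1 ≤ l → l ≤ r → ∑ i, w i ^ l = ∑ i, z i ^ l) :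
    ∏ i, (X - C (w i)) = ∏ i, (X - C (z i)) := by
  have aux : ∀ w : Fin r → R, ∏ i, (X - C (w i)) = ∑ j ∈ Finset.range (r + 1),
      (-1) ^ j * (C (MvPolynomial.aeval w (MvPolynomial.esymm (Fin r) R j)) * X ^ (r - j)) := by
    intro w
    have := Multiset.prod_X_sub_X_eq_sum_esymm ((Finset.univ : Finset (Fin r)).val.map w)
    simp only [Multiset.map_map, Multiset.card_map, Finset.card_val, Finset.card_univ,
      Fintype.card_fin, Function.comp_def] at this
    simp only [MvPolynomial.aeval_esymm_eq_multiset_esymm]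
    exact this
  rw [aux, aux]
  refine Finset.sum_congr rfl fun j hj => ?_
  rw [fw_esymm_eq hu w z h j (by simp at hj; omega)]

open Polynomial in
lemma fw_psum_all {R : Type*} [CommRing R] {r : ℕ} (hu : ∀ l : ℕ, 1 ≤ l → l ≤ r → IsUnit (l : R))
    (w z : Fin r → R) (h : ∀ l : ℕ, 1 ≤ l → l ≤ r → ∑ i, w i ^ l = ∑ i, z i ^ l) (l : ℕ) :
    ∑ i, w i ^ l = ∑ i, z i ^ l := by
  nontriviality R
  have hP := fw_prod_eq hu w z h
  set P : R[X] := ∏ i, (X - C (w i)) with hPdef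
  have hmon : P.Monic := monic_prod_of_monic _ _ (fun i _ => monic_X_sub_C _)
  have hdeg : P.natDegree = r := by
    rw [hPdef, natDegree_prod_of_monic _ _ (fun i _ => monic_X_sub_C _)]; simp
  have hw : ∀ i, P.eval (w i) = 0 := by
    intro i; rw [hPdef, eval_prod]
    exact Finset.prod_eq_zero (Finset.mem_univ i) (by simp)
  have hz : ∀ i, P.eval (z i) = 0 := by
    intro i; rw [hP, eval_prod]
    exact Finset.prod_eq_zero (Finset.mem_univ i) (by simp)
  set Q := (X ^ l : R[X]) %ₘ P with hQ
  have e1 : ∀ y, P.eval y = 0 → y ^ l = ∑ m ∈ Finset.range (r+1), Q.coeff m * y ^ m := by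
    intro y hy
    have := modByMonic_add_div (X ^ l : R[X]) P
    have h2 := congrArg (eval y) this
    simp only [eval_add, eval_mul, hy, zero_mul, add_zero, eval_pow, eval_X] at h2
    rw [← h2, eval_eq_sum_range' (n := r+1)]
    have := natDegree_modByMonic_le (X ^ l : R[X]) hmon
    omega
  rw [Finset.sum_congr rfl (fun i _ => e1 _ (hw i)), Finset.sum_congr rfl (fun i _ => e1 _ (hz i)),
    Finset.sum_comm, Finset.sum_comm (s := Finset.univ)]
  refine Finset.sum_congr rfl fun m hm => ?_
  rw [← Finset.mul_sum, ← Finset.mul_sum]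
  congr 1
  rcases Nat.eq_zero_or_pos m with rfl | hm0
  · simp
  · exact h m hm0 (by simp at hm; omega)

lemma fw_unit {p : ℕ} (hp : p.Prime) (e l : ℕ) (h1 : 1 ≤ l) (h2 : l < p) :
    IsUnit (l : ZMod (p ^ e)) := by
  rw [ZMod.isUnit_iff_coprime]
  exact Nat.Coprime.pow_right _ ((Nat.coprime_of_lt_prime (by omega) h2 hp).symm)

lemma fw_cast_dvd {q : ℕ} (a : ℤ) : (q : ℤ) ∣ a ↔ (a : ZMod q) = 0 :=
  (ZMod.intCast_zmod_eq_zero_iff_dvd a q).symm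

lemma fw_int_psum {p : ℕ} (hp : p.Prime) {r : ℕ} (hr : r < p) (e : ℕ) (w z : Fin r → ℤ)
    (h : ∀ l : ℕ, 1 ≤ l → l ≤ r → (p : ℤ) ^ e ∣ ∑ i, w i ^ l - ∑ i, z i ^ l) (l : ℕ) :
    (p : ℤ) ^ e ∣ ∑ i, w i ^ l - ∑ i, z i ^ l := by
  have := fw_psum_all (R := ZMod (p ^ e)) (fun l h1 h2 => fw_unit hp e l h1 (by omega))
    (fun i => (w i : ZMod (p ^ e))) (fun i => (z i : ZMod (p ^ e))) (by
      intro l h1 h2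
      have := h l h1 h2
      rw [← Nat.cast_pow, fw_cast_dvd] at this
      push_cast at this
      exact sub_eq_zero.mp this) l
  rw [← Nat.cast_pow, fw_cast_dvd]
  push_cast
  exact sub_eq_zero.mpr this

open Polynomial in
lemma fw_int_prod {p : ℕ} (hp : p.Prime) {r : ℕ} (hr : r < p) (e : ℕ) (w z : Fin r → ℤ)
    (h : ∀ l : ℕ, 1 ≤ l → l ≤ r → (p : ℤ) ^ e ∣ ∑ i, w i ^ l - ∑ i, z i ^ l) (j : Fin r) :
    (p : ℤ) ^ e ∣ ∏ i, (z j - w i) := by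
  have := fw_prod_eq (R := ZMod (p ^ e)) (fun l h1 h2 => fw_unit hp e l h1 (by omega))
    (fun i => (w i : ZMod (p ^ e))) (fun i => (z i : ZMod (p ^ e))) (by
      intro l h1 h2
      have := h l h1 h2
      rw [← Nat.cast_pow, fw_cast_dvd] at this
      push_cast at this
      exact sub_eq_zero.mp this)
  have h2 := congrArg (eval (z j : ZMod (p ^ e))) this
  rw [eval_prod, eval_prod, Finset.prod_eq_zero (f := fun i => eval (z j : ZMod (p ^ e)) (X - C (z i : ZMod (p ^ e)))) (Finset.mem_univ j) (by simp)] at h2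
  rw [← Nat.cast_pow, fw_cast_dvd]
  push_cast
  simpa using h2

open Polynomial in
lemma fw_det {p : ℕ} (hp : p.Prime) {r t : ℕ} (hk : r + t < p) (ζ : ℤ) (hζ : ¬ (p : ℤ) ∣ ζ) :
    ¬ (p : ℤ) ∣ (Matrix.of (fun (j l : Fin r) =>
      ((t + 1 + j).choose (l + 1) : ℤ) * ζ ^ (t + 1 + (j : ℕ) - (l + 1)))).det := by
  intro hdvd
  have : Fact p.Prime := ⟨hp⟩
  rw [fw_cast_dvd] at hdvd
  change Int.castRingHom (ZMod p) _ = 0 at hdvd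
  rw [RingHom.map_det] at hdvd
  obtain ⟨v, hv0, hv⟩ := Matrix.exists_vecMul_eq_zero_iff.mpr hdvd
  apply hv0
  rw [fw_cast_dvd] at hζ
  set y : ZMod p := (ζ : ZMod p) with hy
  set Q : (ZMod p)[X] := ∑ j : Fin r, C (v j) * X ^ (t + 1 + (j : ℕ)) with hQ
  have hT : ∀ l : ℕ, 1 ≤ l → l ≤ r → (taylor y Q).coeff l = 0 := by
    intro l h1 h2
    have := congrFun hv ⟨l - 1, by omega⟩
    simp only [Matrix.vecMul, dotProduct, RingHom.mapMatrix_apply, Matrix.map_apply, Matrix.of_apply,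
      Pi.zero_apply, Int.coe_castRingHom] at this
    rw [taylor_coeff, hQ, map_sum, eval_finsetSum, ← this]
    refine Finset.sum_congr rfl fun j _ => ?_
    rw [C_mul_X_pow_eq_monomial, hasseDeriv_monomial, eval_monomial]
    have hl : l - 1 + 1 = l := by omega
    simp only [hl]
    push_cast
    ring
  have hX : (X : (ZMod p)[X]) ^ (r + 1) ∣ taylor y (Q - C (Q.eval y)) := by
    rw [X_pow_dvd_iff]
    intro d hd
    rcases Nat.eq_zero_or_pos d with rfl | hd0
    · simp
    · rw [map_sub, coeff_sub, hT d hd0 (by omega), taylor_C, coeff_C]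
      simp; omega
  have hX2 : (X - C y : (ZMod p)[X]) ^ (r + 1) ∣ Q - C (Q.eval y) := by
    obtain ⟨g, hg⟩ := hX
    refine ⟨taylor (-y) g, ?_⟩
    have h3 := congrArg (taylor (-y)) hg
    rw [taylor_taylor] at h3
    simp only [neg_add_cancel, taylor_zero, taylor_mul, taylor_pow, taylor_X] at h3
    rw [h3]; simp [sub_eq_add_neg]
  have hD : (X - C y : (ZMod p)[X]) ^ r ∣ derivative Q := by
    obtain ⟨g, hg⟩ := hX2
    have : derivative Q = derivative (Q - C (Q.eval y)) := by simp
    rw [this, hg, derivative_mul, derivative_pow]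
    refine dvd_add ?_ ?_
    · refine Dvd.dvd.mul_right (Dvd.dvd.mul_right (Dvd.dvd.mul_left ?_ _) _) _
      simp
    · exact (pow_dvd_pow _ (by omega)).mul_right _
  have hD2 : (X : (ZMod p)[X]) ^ t ∣ derivative Q := by
    rw [hQ, derivative_sum]
    refine Finset.dvd_sum fun j _ => ?_
    rw [derivative_C_mul_X_pow]
    exact (pow_dvd_pow _ (by omega)).mul_left _
  have hcop : IsCoprime ((X : (ZMod p)[X]) ^ t) ((X - C y) ^ r) := by
    apply IsCoprime.pow
    have := isCoprime_X_sub_C_of_isUnit_sub (R := ZMod p) (a := 0) (b := y)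
      (by rw [zero_sub]; exact (IsUnit.mk0 _ hζ).neg)
    simpa using this
  have hmul := hcop.mul_dvd hD2 hD
  have hdeg : (derivative Q).degree < (r + t : ℕ) := by
    rw [hQ, derivative_sum]
    refine (degree_sum_le _ _).trans_lt ?_
    rw [Finset.sup_lt_iff (by exact WithBot.bot_lt_coe _)]
    intro j _
    rw [derivative_C_mul_X_pow]
    refine (degree_C_mul_X_pow_le _ _).trans_lt ?_
    have := j.2
    exact_mod_cast (by omega : t + 1 + (j : ℕ) - 1 < r + t)
  have hQ0 : derivative Q = 0 := by
    by_contra hne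
    have h1 := degree_le_of_dvd hmul hne
    have h2 : (X ^ t * (X - C y) ^ r : (ZMod p)[X]).degree = (r + t : ℕ) := by
      rw [degree_mul, degree_pow, degree_pow, degree_X, degree_X_sub_C]
      push_cast; simp; ring
    rw [h2] at h1
    exact absurd h1 (not_le.mpr hdeg)
  funext j
  have h5 := congrArg (fun P => coeff P (t + (j : ℕ))) hQ0
  simp only [coeff_derivative, coeff_zero] at h5
  have h6 : Q.coeff (t + (j : ℕ) + 1) = v j := by
    rw [hQ, finsetSum_coeff, Finset.sum_eq_single j]
    · rw [coeff_C_mul_X_pow, if_pos (by omega)]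
    · intro i _ hij
      rw [coeff_C_mul_X_pow, if_neg]
      intro h; apply hij; ext; omega
    · simp
  rw [h6] at h5
  rcases mul_eq_zero.mp h5 with h | h
  · exact h
  · exfalso
    have : ((t + (j : ℕ) + 1 : ℕ) : ZMod p) = 0 := by exact_mod_cast h
    rw [ZMod.natCast_eq_zero_iff] at this
    have h8 := Nat.le_of_dvd (by omega) this
    have := j.2
    omega

lemma fw_cong {p : ℕ} (hp : p.Prime) {r t : ℕ} (hk : r + t < p) {a b' m : ℕ} (ha : 1 ≤ a)
    (ζ : ℤ) (hζ : ¬ (p : ℤ) ∣ ζ) (u v : Fin r → ℤ) (hu : ∀ i, (p : ℤ) ^ a ∣ u i - ζ)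
    (hv : ∀ i, (p : ℤ) ^ a ∣ v i - ζ)
    (hdist : ∀ i j, i ≠ j → ¬ (p : ℤ) ^ (a + 1) ∣ u i - u j)
    (hc : ∀ j, t + 1 ≤ j → j ≤ t + r → (p : ℤ) ^ m ∣ ∑ i, u i ^ j - ∑ i, v i ^ j)
    (hb : b' + r * a ≤ m + a) (j : Fin r) : ∃ i, (p : ℤ) ^ b' ∣ v j - u i := by
  rcases le_or_gt b' a with hba | hba
  · refine ⟨j, (pow_dvd_pow _ hba).trans ?_⟩
    have := dvd_sub (hv j) (hu j)
    simpa using this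
  obtain ⟨M, rfl⟩ : ∃ M, b' = a + M := ⟨b' - a, by omega⟩
  have hp0 : (p : ℤ) ≠ 0 := by exact_mod_cast hp.ne_zero
  have hpi : Prime (p : ℤ) := Nat.prime_iff_prime_int.mp hp
  choose w hw using hu
  choose z hz using hv
  have hw' : ∀ i, u i = p ^ a * w i + ζ := fun i => by linarith [hw i]
  have hz' : ∀ i, v i = p ^ a * z i + ζ := fun i => by linarith [hz i]
  set S : ℕ → ℤ := fun l => ∑ i, w i ^ l - ∑ i, z i ^ l with hS
  have hexp : ∀ j, j ≤ t + r → ∑ i, u i ^ j - ∑ i, v i ^ j =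
      ∑ l ∈ Finset.range (t + r + 1), (j.choose l : ℤ) * ζ ^ (j - l) * p ^ (a * l) * S l := by
    intro j hj
    have e1 : ∀ y : ℤ, (p ^ a * y + ζ) ^ j =
        ∑ l ∈ Finset.range (t + r + 1), (j.choose l : ℤ) * ζ ^ (j - l) * p ^ (a * l) * y ^ l := by
      intro y
      rw [add_pow, ← Finset.sum_subset (Finset.range_mono (by omega : j + 1 ≤ t + r + 1))]
      · refine Finset.sum_congr rfl fun l _ => ?_
        rw [mul_pow, ← pow_mul]; ring
      · intro l _ h2
        rw [Nat.choose_eq_zero_of_lt (by simpa using h2)]; simp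
    simp only [hw', hz', e1, hS]
    rw [Finset.sum_comm, Finset.sum_comm (s := Finset.univ), ← Finset.sum_sub_distrib]
    refine Finset.sum_congr rfl fun l _ => ?_
    rw [← Finset.mul_sum, ← Finset.mul_sum]; ring
  have hdet := fw_det hp hk ζ hζ
  set A := Matrix.of (fun (j l : Fin r) =>
      ((t + 1 + j).choose (l + 1) : ℤ) * ζ ^ (t + 1 + (j : ℕ) - (l + 1))) with hA
  have hind : ∀ e, e ≤ M → ∀ l : ℕ, 1 ≤ l → l ≤ r → (p : ℤ) ^ e ∣ S l := by
    intro e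
    induction e with
    | zero => intro _ l _ _; simp
    | succ e ih =>
      intro he
      have hall : ∀ l, (p : ℤ) ^ e ∣ S l := fw_int_psum hp (by omega) e w z (ih (by omega))
      set σ : Fin r → ℤ := fun l => p ^ (a * (l + 1)) * S (l + 1) with hσ
      have hD : ∀ jj : Fin r, (p : ℤ) ^ (a * r + e + 1) ∣ (A.mulVec σ) jj := by
        intro jj
        have h1 := hc (t + 1 + jj) (by omega) (by omega)
        rw [hexp _ (by omega), Finset.range_eq_Ico,
          ← Finset.sum_Ico_consecutive _ (Nat.zero_le (r+1)) (by omega), ← Finset.range_eq_Ico,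
          Finset.sum_range_succ'] at h1
        have hS0 : S 0 = 0 := by simp [hS]
        rw [hS0, mul_zero, add_zero, Finset.sum_range] at h1
        have hm : a * r + e + 1 ≤ m := by nlinarith
        have h2 : (p : ℤ) ^ (a * r + e + 1) ∣ ∑ l ∈ Finset.Ico (r + 1) (t + r + 1),
            ((t + 1 + jj).choose l : ℤ) * ζ ^ (t + 1 + (jj : ℕ) - l) * p ^ (a * l) * S l := by
          refine Finset.dvd_sum fun l hl => ?_
          have hl' := (Finset.mem_Ico.mp hl).1
          have h3 : (p : ℤ) ^ (a * r + e + 1) ∣ p ^ (a * l) * S l := by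
            have : (p : ℤ) ^ (a * r + 1 + e) ∣ p ^ (a * l) * S l := by
              rw [pow_add]
              exact mul_dvd_mul (pow_dvd_pow _ (by nlinarith)) (hall l)
            rwa [show a * r + e + 1 = a * r + 1 + e by ring]
          rw [mul_assoc]
          exact h3.mul_left _
        have h4 := (dvd_add_left h2).mp ((pow_dvd_pow _ hm).trans h1)
        have h5 : (A.mulVec σ) jj = ∑ i : Fin r, ((t + 1 + jj).choose (i + 1) : ℤ) *
            ζ ^ (t + 1 + (jj : ℕ) - (i + 1)) * p ^ (a * (i + 1)) * S (i + 1) := by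
          simp only [Matrix.mulVec, dotProduct, hA, Matrix.of_apply, hσ]
          refine Finset.sum_congr rfl fun i _ => by ring
        rw [h5]; exact h4
      intro l h1 h2
      have h3 : A.adjugate.mulVec (A.mulVec σ) = A.det • σ := by
        rw [Matrix.mulVec_mulVec, Matrix.adjugate_mul, Matrix.smul_mulVec, Matrix.one_mulVec]
      have h4 := congrFun h3 ⟨l - 1, by omega⟩
      have h5 : (p : ℤ) ^ (a * r + e + 1) ∣ A.adjugate.mulVec (A.mulVec σ) ⟨l - 1, by omega⟩ := by
        simp only [Matrix.mulVec, dotProduct] at hD ⊢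
        exact Finset.dvd_sum fun i _ => (hD i).mul_left _
      rw [h4] at h5
      have hl : l - 1 + 1 = l := by omega
      simp only [Pi.smul_apply, smul_eq_mul, hσ, hl] at h5
      have h6 : (p : ℤ) ^ (a * l + (e + 1)) ∣ A.det * (p ^ (a * l) * S l) :=
        (pow_dvd_pow _ (by nlinarith)).trans h5
      have h7 : IsCoprime ((p : ℤ) ^ (a * l + (e + 1))) A.det :=
        IsCoprime.pow_left ((Prime.coprime_iff_not_dvd hpi).mpr hdet)
      have h8 := h7.dvd_of_dvd_mul_left h6
      rw [pow_add] at h8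
      exact (mul_dvd_mul_iff_left (pow_ne_zero _ hp0)).mp h8
  have hprod := fw_int_prod hp (by omega : r < p) M w z (hind M le_rfl) j
  have hfin : ∃ i, (p : ℤ) ^ M ∣ z j - w i := by
    have hM : M ≠ 0 := by omega
    obtain ⟨i, _, hi⟩ := (hpi.dvd_finsetProd_iff _).mp ((dvd_pow_self _ hM).trans hprod)
    refine ⟨i, ?_⟩
    rw [← Finset.mul_prod_erase _ _ (Finset.mem_univ i)] at hprod
    refine IsCoprime.dvd_of_dvd_mul_right ?_ hprod
    refine IsCoprime.pow_left (IsCoprime.prod_right fun i' hi' => ?_)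
    rw [Prime.coprime_iff_not_dvd hpi]
    intro h9
    apply hdist i i' (Finset.ne_of_mem_erase hi').symm
    have h10 := dvd_sub h9 hi
    rw [hw', hw', pow_succ]
    have : (p : ℤ) ^ a * w i + ζ - (p ^ a * w i' + ζ) = p ^ a * (z j - w i' - (z j - w i)) := by ring
    rw [this]
    exact mul_dvd_mul_left _ h10
  obtain ⟨i, hi⟩ := hfin
  refine ⟨i, ?_⟩
  rw [hw', hz', pow_add]
  have : (p : ℤ) ^ a * z j + ζ - (p ^ a * w i + ζ) = p ^ a * (z j - w i) := by ring
  rw [this]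
  exact mul_dvd_mul_left _ hi


lemma fw_newton_abs (n : ℕ) : ∃ C : ℝ, 0 ≤ C ∧ ∀ (e P : ℕ → ℂ) (A : ℝ), 0 < A → e 0 = 1 →
    (∀ i, 2 ≤ i → ‖P i‖ ≤ A ^ i) →
    (∀ n : ℕ, n * e n = (-1) ^ (n + 1) * ∑ i ∈ Finset.range n, (-1) ^ i * e i * P (n - i)) →
    ‖e n - P 1 ^ n / n.factorial‖ * (‖P 1‖ + A) ≤ C * A * (‖P 1‖ + A) ^ n := by
  induction n using Nat.strong_induction_on with
  | _ n ih =>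
    rcases n with _ | n
    · exact ⟨0, le_rfl, fun e P A hA h0 _ _ => by simp [h0]⟩
    choose! c hc0 hc using ih
    refine ⟨c n + ∑ i ∈ Finset.range n, (1 + c i), ?_, ?_⟩
    · exact add_nonneg (hc0 n (by omega)) (Finset.sum_nonneg fun i hi => by
        have := hc0 i (by simp at hi; omega); linarith)
    intro e P A hA h0 hP hN
    set B := ‖P 1‖ + A with hB
    have hBpos : 0 < B := by have := norm_nonneg (P 1); linarith
    have hAB : A ≤ B := by have := norm_nonneg (P 1); linarith
    have hPB : ‖P 1‖ ≤ B := by linarith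
    have he : ∀ i, i < n → ‖e i‖ ≤ (1 + c i) * B ^ i := by
      intro i hi
      have h1 := hc i (by omega) e P A hA h0 hP hN
      have h2 : ‖e i - P 1 ^ i / i.factorial‖ ≤ c i * B ^ i := by
        have : ‖e i - P 1 ^ i / i.factorial‖ * B ≤ c i * B ^ i * B := by
          refine h1.trans ?_
          have := mul_le_mul_of_nonneg_left hAB (mul_nonneg (hc0 i (by omega)) (pow_nonneg hBpos.le i))
          linarith
        exact le_of_mul_le_mul_right this hBpos
      have h3 : ‖P 1 ^ i / i.factorial‖ ≤ B ^ i := by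
        rw [norm_div, norm_pow, Complex.norm_natCast]
        refine (div_le_self (by positivity) ?_).trans (pow_le_pow_left₀ (norm_nonneg _) hPB i)
        exact_mod_cast Nat.factorial_pos i
      calc ‖e i‖ = ‖(e i - P 1 ^ i / i.factorial) + P 1 ^ i / i.factorial‖ := by ring_nf
        _ ≤ _ := norm_add_le _ _
        _ ≤ _ := by linarith
    have h1 := hN (n + 1)
    rw [Finset.sum_range_succ, mul_add, show n + 1 - n = 1 by omega] at h1
    have hs : (-1 : ℂ) ^ (n + 1 + 1) * ((-1) ^ n * e n * P 1) = e n * P 1 := by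
      have : (-1 : ℂ) ^ (n + 1 + 1) * (-1) ^ n = 1 := by
        rw [← pow_add]; exact Even.neg_one_pow ⟨n + 1, by ring⟩
      linear_combination e n * P 1 * this
    rw [hs] at h1
    have hn1 : ((n : ℂ) + 1) ≠ 0 := by exact_mod_cast (Nat.succ_ne_zero n)
    have hnf : (n.factorial : ℂ) ≠ 0 := by exact_mod_cast (Nat.factorial_ne_zero n)
    have h2 : ((n + 1 : ℕ) : ℂ) * (e (n + 1) - P 1 ^ (n + 1) / (n + 1).factorial) =
        (e n - P 1 ^ n / n.factorial) * P 1 + (-1) ^ (n + 1 + 1) *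
          ∑ i ∈ Finset.range n, (-1) ^ i * e i * P (n + 1 - i) := by
      rw [mul_sub, h1, Nat.factorial_succ]
      push_cast
      field_simp
      ring
    have h3 := hc n (by omega) e P A hA h0 hP hN
    have h4 : ‖∑ i ∈ Finset.range n, (-1) ^ i * e i * P (n + 1 - i)‖ * B ≤
        (∑ i ∈ Finset.range n, (1 + c i)) * A * B ^ (n + 1) := by
      rw [Finset.sum_mul, Finset.sum_mul]
      refine (mul_le_mul_of_nonneg_right (norm_sum_le _ _) hBpos.le).trans ?_
      rw [Finset.sum_mul]
      refine Finset.sum_le_sum fun i hi => ?_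
      have hi' : i < n := by simpa using hi
      rw [norm_mul, norm_mul, norm_pow, norm_neg, norm_one, one_pow, one_mul]
      have h5 := he i hi'
      have h6 : ‖P (n + 1 - i)‖ ≤ A * B ^ (n - i) := by
        refine (hP _ (by omega)).trans ?_
        rw [show n + 1 - i = (n - i) + 1 by omega, pow_succ, mul_comm]
        exact mul_le_mul_of_nonneg_left (pow_le_pow_left₀ hA.le hAB _) hA.le
      calc ‖e i‖ * ‖P (n + 1 - i)‖ * B ≤ ((1 + c i) * B ^ i) * (A * B ^ (n - i)) * B := by gcongr; exact (norm_nonneg _).trans h5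
        _ = (1 + c i) * A * B ^ (i + (n - i) + 1) := by ring
        _ = _ := by rw [show i + (n - i) + 1 = n + 1 by omega]
    have h7 : ‖((n + 1 : ℕ) : ℂ) * (e (n + 1) - P 1 ^ (n + 1) / (n + 1).factorial)‖ * B ≤
        (c n + ∑ i ∈ Finset.range n, (1 + c i)) * A * B ^ (n + 1) := by
      rw [h2]
      calc _ ≤ (‖(e n - P 1 ^ n / n.factorial) * P 1‖ + ‖(-1) ^ (n + 1 + 1) *
          ∑ i ∈ Finset.range n, (-1) ^ i * e i * P (n + 1 - i)‖) * B := by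
            gcongr; exact norm_add_le _ _
        _ = (‖e n - P 1 ^ n / n.factorial‖ * B) * ‖P 1‖ +
          ‖∑ i ∈ Finset.range n, (-1) ^ i * e i * P (n + 1 - i)‖ * B := by
            rw [norm_mul, norm_mul, norm_pow, norm_neg, norm_one, one_pow, one_mul]; ring
        _ ≤ (c n * A * B ^ n) * B + (∑ i ∈ Finset.range n, (1 + c i)) * A * B ^ (n + 1) := by
            have := mul_nonneg (mul_nonneg (hc0 n (by omega)) hA.le) (pow_nonneg hBpos.le n)
            gcongr
        _ = _ := by ring
    refine le_trans ?_ h7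
    rw [norm_mul, Complex.norm_natCast]
    refine mul_le_mul_of_nonneg_right (le_mul_of_one_le_left (norm_nonneg _) ?_) hBpos.le
    exact_mod_cast Nat.succ_le_succ (Nat.zero_le n)

lemma fw_point1 (r : ℕ) : ∃ C : ℝ, 0 < C ∧ ∀ (Z : Finset ℤ) (z : ℤ → ℂ),
    ‖∑ i ∈ Z, z i‖ ^ r ≤ C * (‖∑ s ∈ Z.powersetCard r, ∏ i ∈ s, z i‖ +
      (Real.sqrt (∑ i ∈ Z, ‖z i‖ ^ 2)) ^ r) := by
  obtain ⟨c, hc0, hc⟩ := fw_newton_abs r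
  set D : ℝ := 2 * (r.factorial * c * 2 ^ r) + 1 with hD
  have hf : (0 : ℝ) < r.factorial := by exact_mod_cast Nat.factorial_pos r
  have hD1 : 1 ≤ D := by rw [hD]; have : 0 ≤ (r.factorial : ℝ) * c * 2 ^ r := by positivity
                         linarith
  refine ⟨D ^ r + 2 * r.factorial + 1, by positivity, ?_⟩
  intro Z z
  set A := Real.sqrt (∑ i ∈ Z, ‖z i‖ ^ 2) with hA
  set e : ℕ → ℂ := fun n => ∑ s ∈ Z.powersetCard n, ∏ i ∈ s, z i with he
  set P : ℕ → ℂ := fun n => ∑ i ∈ Z, z i ^ n with hP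
  have hP1 : ∑ i ∈ Z, z i = P 1 := by simp [hP]
  have hA0 : 0 ≤ A := Real.sqrt_nonneg _
  have hAsq : A ^ 2 = ∑ i ∈ Z, ‖z i‖ ^ 2 := Real.sq_sqrt (Finset.sum_nonneg fun i _ => by positivity)
  have hzA : ∀ i ∈ Z, ‖z i‖ ≤ A := by
    intro i hi
    apply Real.le_sqrt_of_sq_le
    exact Finset.single_le_sum (f := fun i => ‖z i‖ ^ 2) (fun i _ => by positivity) hi
  rw [hP1]
  change _ ≤ _ * (‖e r‖ + _)
  have hE : 0 ≤ ‖e r‖ := norm_nonneg _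
  have hAr : 0 ≤ A ^ r := by positivity
  rcases le_or_gt ‖P 1‖ (D * A) with hcase | hcase
  · calc ‖P 1‖ ^ r ≤ (D * A) ^ r := pow_le_pow_left₀ (norm_nonneg _) hcase r
      _ = D ^ r * A ^ r := mul_pow _ _ _
      _ ≤ _ := by
        have : 0 ≤ D ^ r := by positivity
        nlinarith [mul_nonneg this hE, mul_nonneg hf.le hE, mul_nonneg hf.le hAr]
  have hApos : 0 < A := by
    rcases hA0.eq_or_lt with h | h
    · exfalso
      have h0 : P 1 = 0 := by
        rw [← hP1]
        refine Finset.sum_eq_zero fun i hi => ?_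
        have := hzA i hi
        rw [← h] at this
        simpa using this
      rw [h0, ← h] at hcase; simp at hcase
    · exact h
  have key := hc e P A hApos (by simp [he]) (by
    intro i hi
    calc ‖P i‖ ≤ ∑ j ∈ Z, ‖z j ^ i‖ := norm_sum_le _ _
      _ = ∑ j ∈ Z, ‖z j‖ ^ 2 * ‖z j‖ ^ (i - 2) := by
          refine Finset.sum_congr rfl fun j _ => ?_
          rw [norm_pow, ← pow_add]; congr 1; omega
      _ ≤ ∑ j ∈ Z, ‖z j‖ ^ 2 * A ^ (i - 2) := by
          refine Finset.sum_le_sum fun j hj => ?_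
          gcongr
          exact hzA j hj
      _ = A ^ i := by
          rw [← Finset.sum_mul, ← hAsq, ← pow_add]; congr 1; omega) (by
    intro n
    have h := congrArg (MvPolynomial.aeval (fun i : Z => z i)) (MvPolynomial.mul_esymm_eq_sum Z ℂ n)
    have hes : ∀ n, MvPolynomial.aeval (fun i : Z => z i) (MvPolynomial.esymm Z ℂ n) = e n := by
      intro n
      rw [MvPolynomial.aeval_esymm_eq_multiset_esymm, he]
      simp only
      rw [← Finset.esymm_map_val]
      congr 1
      have : (Finset.univ : Finset Z).val = Z.val.attach := rfl
      rw [this]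
      conv_rhs => rw [← Multiset.attach_map_val Z.val]
      rw [Multiset.map_map]; rfl
    have hps : ∀ n, MvPolynomial.aeval (fun i : Z => z i) (MvPolynomial.psum Z ℂ n) = P n := by
      intro n
      simp only [MvPolynomial.psum, map_sum, map_pow, MvPolynomial.aeval_X, hP]
      exact Finset.sum_coe_sort Z (fun i => z i ^ n)
    simp only [map_mul, map_natCast, map_sum, map_pow, map_neg, map_one, hes, hps] at h
    rw [h, Finset.sum_filter, Finset.Nat.sum_antidiagonal_eq_sum_range_succ_mk,
      Finset.sum_range_succ]
    simp only [lt_irrefl, if_false, add_zero]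
    congr 1
    refine Finset.sum_congr rfl fun i hi => ?_
    rw [if_pos (by simpa using hi)])
  set B := ‖P 1‖ + A with hB
  have hM : 0 < ‖P 1‖ := lt_of_le_of_lt (by positivity) hcase
  have hBpos : 0 < B := by linarith
  have hB2 : B ≤ 2 * ‖P 1‖ := by nlinarith
  have h1 : ‖P 1‖ ^ r / r.factorial ≤ ‖e r‖ + ‖e r - P 1 ^ r / r.factorial‖ := by
    have : ‖P 1 ^ r / r.factorial‖ = ‖P 1‖ ^ r / r.factorial := by
      rw [norm_div, norm_pow, Complex.norm_natCast]
    rw [← this]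
    have := norm_sub_le (e r) (e r - P 1 ^ r / r.factorial)
    simpa using this
  have h2 : ‖P 1‖ ^ r * B ≤ r.factorial * ‖e r‖ * B + r.factorial * (c * A * B ^ r) := by
    rw [div_le_iff₀ hf] at h1
    nlinarith
  have h3 : r.factorial * (c * A * B ^ r) ≤ ‖P 1‖ ^ r * (B / 2) := by
    calc r.factorial * (c * A * B ^ r) ≤ r.factorial * (c * A * (2 * ‖P 1‖) ^ r) := by gcongr
      _ = (r.factorial * c * 2 ^ r * A) * ‖P 1‖ ^ r := by rw [mul_pow]; ring
      _ ≤ (B / 2) * ‖P 1‖ ^ r := by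
        gcongr
        have : D * A ≤ B := by linarith
        rw [hD] at this
        nlinarith
      _ = _ := by ring
  have h4 : ‖P 1‖ ^ r * (B / 2) ≤ (2 * r.factorial * ‖e r‖) * (B / 2) := by nlinarith
  have h5 := le_of_mul_le_mul_right h4 (by linarith)
  have : 0 ≤ D ^ r := by positivity
  nlinarith [mul_nonneg this hE, mul_nonneg hf.le hE, mul_nonneg hf.le hAr, mul_nonneg this hAr]

lemma fw_esymm_strict (r : ℕ) (Z : Finset ℤ) (z : ℤ → ℂ) :
    ∑ s ∈ Z.powersetCard r, ∏ i ∈ s, z i =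
      ∑ g ∈ (Fintype.piFinset (fun _ : Fin r => Z)).filter (fun g => StrictMono g), ∏ i, z (g i) := by
  symm
  refine Finset.sum_bij (fun g _ => Finset.univ.image g) ?_ ?_ ?_ ?_
  · intro g hg
    simp only [Finset.mem_filter, Fintype.mem_piFinset] at hg
    rw [Finset.mem_powersetCard]
    refine ⟨?_, ?_⟩
    · intro x hx
      obtain ⟨i, _, rfl⟩ := Finset.mem_image.mp hx
      exact hg.1 i
    · rw [Finset.card_image_of_injective _ hg.2.injective]; simp
  · intro g hg g' hg' h
    simp only [Finset.mem_filter, Fintype.mem_piFinset] at hg hg'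
    apply StrictMono.range_inj hg.2 hg'.2 |>.mp
    have := congrArg (fun s : Finset ℤ => (s : Set ℤ)) h
    simpa using this
  · intro s hs
    rw [Finset.mem_powersetCard] at hs
    refine ⟨s.orderEmbOfFin hs.2, ?_, ?_⟩
    · simp only [Finset.mem_filter, Fintype.mem_piFinset]
      exact ⟨fun i => hs.1 (Finset.orderEmbOfFin_mem s hs.2 i), (s.orderEmbOfFin hs.2).strictMono⟩
    · apply Finset.coe_injective
      simp
  · intro g hg
    simp only [Finset.mem_filter, Fintype.mem_piFinset] at hg
    rw [Finset.prod_image (fun a _ b _ h => hg.2.injective h)]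

lemma fw_point (r q : ℕ) (hr : 1 ≤ r) (hq : 1 ≤ q) : ∃ C : ℝ, 0 < C ∧ ∀ (Z : Finset ℤ) (z : ℤ → ℂ),
    ‖∑ i ∈ Z, z i‖ ^ (2 * (r * q)) ≤ C * (‖∑ g ∈ (Fintype.piFinset (fun _ : Fin r => Z)).filter
      (fun g => StrictMono g), ∏ i, z (g i)‖ ^ (2 * q) +
      (Z.card : ℝ) ^ (r * q - 1) * ∑ i ∈ Z, ‖z i‖ ^ (2 * (r * q))) := by
  obtain ⟨C, hC, h⟩ := fw_point1 r
  refine ⟨C ^ (2 * q) * 2 ^ (2 * q - 1), by positivity, ?_⟩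
  intro Z z
  have h1 := h Z z
  rw [fw_esymm_strict] at h1
  set E := ‖∑ g ∈ (Fintype.piFinset (fun _ : Fin r => Z)).filter
      (fun g => StrictMono g), ∏ i, z (g i)‖
  set A := Real.sqrt (∑ i ∈ Z, ‖z i‖ ^ 2) with hA
  have hA0 : 0 ≤ A := Real.sqrt_nonneg _
  have hAsq : A ^ 2 = ∑ i ∈ Z, ‖z i‖ ^ 2 := Real.sq_sqrt (Finset.sum_nonneg fun i _ => by positivity)
  have hAp : A ^ (2 * (r * q)) ≤ (Z.card : ℝ) ^ (r * q - 1) * ∑ i ∈ Z, ‖z i‖ ^ (2 * (r * q)) := by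
    obtain ⟨m, hm⟩ : ∃ m, r * q = m + 1 := ⟨r * q - 1, by have := Nat.mul_le_mul hr hq; omega⟩
    rw [pow_mul, hAsq, hm]
    have := pow_sum_div_card_le_sum_pow (s := Z) (f := fun i => ‖z i‖ ^ 2) (fun i _ => by positivity) m
    rcases Z.eq_empty_or_nonempty with rfl | hne
    · simp
    · have hc : (0 : ℝ) < Z.card := by exact_mod_cast hne.card_pos
      rw [div_le_iff₀ (by positivity)] at this
      simp only [← pow_mul] at this ⊢
      rw [Nat.add_sub_cancel]
      linarith
  calc ‖∑ i ∈ Z, z i‖ ^ (2 * (r * q)) = (‖∑ i ∈ Z, z i‖ ^ r) ^ (2 * q) := by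
        rw [← pow_mul]; congr 1; ring
    _ ≤ (C * (E + A ^ r)) ^ (2 * q) := pow_le_pow_left₀ (by positivity) h1 _
    _ = C ^ (2 * q) * (E + A ^ r) ^ (2 * q) := mul_pow _ _ _
    _ ≤ C ^ (2 * q) * (2 ^ (2 * q - 1) * (E ^ (2 * q) + (A ^ r) ^ (2 * q))) := by
        gcongr
        exact add_pow_le (norm_nonneg _) (by positivity) _
    _ = C ^ (2 * q) * 2 ^ (2 * q - 1) * (E ^ (2 * q) + A ^ (2 * (r * q))) := by
        rw [← pow_mul, show r * (2 * q) = 2 * (r * q) by ring]; ring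
    _ ≤ _ := by gcongr


noncomputable def fwE {k M : ℕ} [NeZero M] (α : Fin k → ZMod M) (v : Fin k → ℤ) : ℂ :=
  ZMod.stdAddChar (∑ j, α j * ((v j : ℤ) : ZMod M))

noncomputable def fwX {k M : ℕ} [NeZero M] (g : (Fin k → ZMod M) → ℝ) : ℝ :=
  (∑ α, g α) / (M : ℝ) ^ k

def fwp (k : ℕ) {r : ℕ} (x : Fin r → ℤ) : Fin k → ℤ := fun j => ∑ i, x i ^ ((j : ℕ) + 1)

noncomputable def fwS {k M : ℕ} [NeZero M] {r : ℕ} (Q : Finset (Fin r → ℤ))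
    (α : Fin k → ZMod M) : ℂ := ∑ x ∈ Q, fwE α (fwp k x)

noncomputable def fwf {k M : ℕ} [NeZero M] (A : Finset ℤ) (α : Fin k → ZMod M) : ℂ :=
  ∑ x ∈ A, fwE α (fun j => x ^ ((j : ℕ) + 1))

section
variable {k M : ℕ} [NeZero M]

lemma fwE_add (α : Fin k → ZMod M) (v w : Fin k → ℤ) : fwE α (v + w) = fwE α v * fwE α w := by
  unfold fwE
  rw [← AddChar.map_add_eq_mul, ← Finset.sum_add_distrib]
  congr 1
  refine Finset.sum_congr rfl fun j _ => ?_
  simp; ring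

lemma fwE_zero (α : Fin k → ZMod M) : fwE α 0 = 1 := by simp [fwE]

lemma fwE_sum {ι : Type*} (s : Finset ι) (α : Fin k → ZMod M) (v : ι → Fin k → ℤ) :
    fwE α (∑ i ∈ s, v i) = ∏ i ∈ s, fwE α (v i) := by
  classical
  induction s using Finset.induction_on with
  | empty => simp [fwE_zero]
  | insert a s ha ih => rw [Finset.sum_insert ha, Finset.prod_insert ha, fwE_add, ih]

lemma fwE_conj (α : Fin k → ZMod M) (v : Fin k → ℤ) :
    (starRingEnd ℂ) (fwE α v) = fwE α (-v) := by
  unfold fwE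
  rw [← AddChar.map_neg_eq_conj]
  congr 1
  simp

lemma fwE_orth (v : Fin k → ℤ) :
    ∑ α : Fin k → ZMod M, fwE α v = if ∀ j, ((v j : ℤ) : ZMod M) = 0 then (M : ℂ) ^ k else 0 := by
  classical
  have h1 : ∀ α : Fin k → ZMod M, fwE α v = ∏ j, ZMod.stdAddChar (α j * ((v j : ℤ) : ZMod M)) := by
    intro α
    unfold fwE
    have hsum : ∀ s : Finset (Fin k), (ZMod.stdAddChar (∑ j ∈ s, α j * ((v j : ℤ) : ZMod M)) : ℂ)
        = ∏ j ∈ s, ZMod.stdAddChar (α j * ((v j : ℤ) : ZMod M)) := by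
      intro s
      induction s using Finset.induction_on with
      | empty => simp
      | insert a s ha ih => rw [Finset.sum_insert ha, Finset.prod_insert ha,
          AddChar.map_add_eq_mul, ih]
    exact hsum _
  simp_rw [h1]
  have h2 := Finset.prod_univ_sum (fun _ : Fin k => (Finset.univ : Finset (ZMod M)))
    (fun j a => ZMod.stdAddChar (a * ((v j : ℤ) : ZMod M)))
  rw [Fintype.piFinset_univ] at h2
  rw [← h2]
  have h3 : ∀ j, ∑ a : ZMod M, ZMod.stdAddChar (a * ((v j : ℤ) : ZMod M))
      = if ((v j : ℤ) : ZMod M) = 0 then (M : ℂ) else 0 := by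
    intro j
    have := AddChar.sum_mulShift (R := ZMod M) ((v j : ℤ) : ZMod M) (ZMod.isPrimitive_stdAddChar M)
    simp only [ZMod.card] at this
    rw [this]; push_cast; rfl
  simp_rw [h3]
  split_ifs with h
  · simp [h]
  · push Not at h
    obtain ⟨j, hj⟩ := h
    exact Finset.prod_eq_zero (Finset.mem_univ j) (by simp [hj])

lemma fw_count {τ : Type*} [DecidableEq τ] (U : Finset τ) (V : τ → Fin k → ℤ)
    (hV : ∀ u ∈ U, ∀ u' ∈ U, ∀ j, |V u j - V u' j| < M) :
    fwX (fun α : Fin k → ZMod M => ‖∑ u ∈ U, fwE α (V u)‖ ^ 2)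
      = (((U ×ˢ U).filter (fun q => V q.1 = V q.2)).card : ℝ) := by
  unfold fwX
  have hM : (M : ℝ) ^ k ≠ 0 := pow_ne_zero _ (by exact_mod_cast NeZero.ne M)
  rw [div_eq_iff hM]
  have h1 : ∀ α : Fin k → ZMod M, ((‖∑ u ∈ U, fwE α (V u)‖ ^ 2 : ℝ) : ℂ)
      = ∑ q ∈ U ×ˢ U, fwE α (V q.1 - V q.2) := by
    intro α
    rw [Finset.sum_product]
    push_cast
    rw [← Complex.mul_conj', map_sum, Finset.sum_mul_sum]
    refine Finset.sum_congr rfl fun u _ => Finset.sum_congr rfl fun u' _ => ?_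
    rw [fwE_conj, ← fwE_add, sub_eq_add_neg]
  have h2 : ((∑ α : Fin k → ZMod M, ‖∑ u ∈ U, fwE α (V u)‖ ^ 2 : ℝ) : ℂ)
      = ((((U ×ˢ U).filter (fun q => V q.1 = V q.2)).card : ℝ) * (M : ℝ) ^ k : ℝ) := by
    push_cast
    have h1' : ∀ α : Fin k → ZMod M, ((‖∑ u ∈ U, fwE α (V u)‖ : ℝ) : ℂ) ^ 2
      = ∑ q ∈ U ×ˢ U, fwE α (V q.1 - V q.2) := fun α => by rw [← h1 α]; push_cast; rfl
    simp_rw [h1']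
    rw [Finset.sum_comm]
    simp_rw [fwE_orth]
    rw [Finset.card_filter]
    push_cast
    rw [Finset.sum_mul]
    refine Finset.sum_congr rfl fun q hq => ?_
    simp only [Finset.mem_product] at hq
    have : (∀ j, (((V q.1 - V q.2) j : ℤ) : ZMod M) = 0) ↔ V q.1 = V q.2 := by
      constructor
      · intro h
        funext j
        have := (ZMod.intCast_zmod_eq_zero_iff_dvd _ M).mp (h j)
        have h3 := Int.eq_zero_of_abs_lt_dvd this (by simpa using hV _ hq.1 _ hq.2 j)
        simp at h3; linarith
      · intro h j; simp [h]
    simp only [this]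
    split_ifs <;> simp
  exact_mod_cast h2

lemma fwX_mono {g h : (Fin k → ZMod M) → ℝ} (H : ∀ α, g α ≤ h α) : fwX g ≤ fwX h := by
  unfold fwX
  gcongr with α
  exact H α

lemma fwX_nonneg {g : (Fin k → ZMod M) → ℝ} (H : ∀ α, 0 ≤ g α) : 0 ≤ fwX g := by
  unfold fwX
  exact div_nonneg (Finset.sum_nonneg fun α _ => H α) (by positivity)

lemma fwX_add (g h : (Fin k → ZMod M) → ℝ) : fwX (fun α => g α + h α) = fwX g + fwX h := by
  unfold fwX
  rw [Finset.sum_add_distrib, add_div]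

lemma fwX_mul (c : ℝ) (g : (Fin k → ZMod M) → ℝ) : fwX (fun α => c * g α) = c * fwX g := by
  unfold fwX
  rw [← Finset.mul_sum, mul_div_assoc]

lemma fwX_sum {ι : Type*} (s : Finset ι) (g : ι → (Fin k → ZMod M) → ℝ) :
    fwX (fun α => ∑ i ∈ s, g i α) = ∑ i ∈ s, fwX (g i) := by
  unfold fwX
  rw [Finset.sum_comm, Finset.sum_div]

lemma fwS_pi {r : ℕ} (A : Fin r → Finset ℤ) (α : Fin k → ZMod M) :
    fwS (Fintype.piFinset A) α = ∏ i, fwf (A i) α := by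
  unfold fwS fwf
  rw [Finset.prod_univ_sum]
  refine Finset.sum_congr rfl fun x _ => ?_
  rw [← fwE_sum]
  congr 1
  funext j
  simp [fwp]

lemma fwS_mul_pow {r r' : ℕ} (t : ℕ) (Q : Finset (Fin r → ℤ)) (R : Finset (Fin r' → ℤ))
    (α : Fin k → ZMod M) :
    fwS Q α * fwS R α ^ t = ∑ u ∈ Q ×ˢ Fintype.piFinset (fun _ : Fin t => R),
      fwE α (fwp k u.1 + ∑ l, fwp k (u.2 l)) := by
  have h1 : fwS R α ^ t = ∏ _l : Fin t, fwS R α := by simp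
  rw [h1]
  unfold fwS
  rw [Finset.prod_univ_sum, Finset.sum_mul_sum, Finset.sum_product]
  refine Finset.sum_congr rfl fun u _ => Finset.sum_congr rfl fun u' _ => ?_
  rw [fwE_add, fwE_sum]

lemma fwp_bound {r X : ℕ} (x : Fin r → ℤ) (hx : ∀ i, 1 ≤ x i ∧ x i ≤ X) (j : Fin k) :
    0 ≤ fwp k x j ∧ fwp k x j ≤ r * (X : ℤ) ^ k := by
  unfold fwp
  constructor
  · exact Finset.sum_nonneg fun i _ => pow_nonneg (by linarith [(hx i).1]) _
  · calc ∑ i, x i ^ ((j : ℕ) + 1) ≤ ∑ _i : Fin r, (X : ℤ) ^ k := by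
          refine Finset.sum_le_sum fun i _ => ?_
          calc x i ^ ((j : ℕ) + 1) ≤ (X : ℤ) ^ ((j : ℕ) + 1) :=
                pow_le_pow_left₀ (by linarith [(hx i).1]) (hx i).2 _
            _ ≤ (X : ℤ) ^ k := by
                refine pow_le_pow_right₀ ?_ (by omega)
                linarith [(hx i).1, (hx i).2]
      _ = _ := by simp

lemma fw_mv {r t X : ℕ} (hM : (t + 1) * r * X ^ k < M) (Q R : Finset (Fin r → ℤ))
    (hQ : ∀ x ∈ Q, ∀ i, 1 ≤ x i ∧ x i ≤ X) (hR : ∀ x ∈ R, ∀ i, 1 ≤ x i ∧ x i ≤ X) :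
    fwX (fun α : Fin k → ZMod M => ‖fwS Q α‖ ^ 2 * ‖fwS R α‖ ^ (2 * t))
      = ((((Q ×ˢ Fintype.piFinset (fun _ : Fin t => R)) ×ˢ
          (Q ×ˢ Fintype.piFinset (fun _ : Fin t => R))).filter (fun q =>
          fwp k q.1.1 + ∑ l, fwp k (q.1.2 l) = fwp k q.2.1 + ∑ l, fwp k (q.2.2 l))).card : ℝ) := by
  classical
  refine Eq.trans ?_ (fw_count (M := M) (Q ×ˢ Fintype.piFinset (fun _ : Fin t => R))
    (fun u => fwp k u.1 + ∑ l, fwp k (u.2 l)) ?_)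
  · congr 1
    funext α
    rw [← fwS_mul_pow, norm_mul, norm_pow, mul_pow, ← pow_mul, mul_comm t 2]
  · have key : ∀ u ∈ Q ×ˢ Fintype.piFinset (fun _ : Fin t => R), ∀ j,
        0 ≤ (fwp k u.1 + ∑ l, fwp k (u.2 l)) j ∧
        (fwp k u.1 + ∑ l, fwp k (u.2 l)) j ≤ ((t + 1) * r * X ^ k : ℕ) := by
      intro u hu j
      simp only [Finset.mem_product, Fintype.mem_piFinset] at hu
      have h1 := fwp_bound (k := k) u.1 (hQ _ hu.1) j
      have h2 := fun l => fwp_bound (k := k) (u.2 l) (hR _ (hu.2 l)) j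
      simp only [Pi.add_apply, Finset.sum_apply]
      constructor
      · exact add_nonneg h1.1 (Finset.sum_nonneg fun l _ => (h2 l).1)
      · have := Finset.sum_le_sum fun l (_ : l ∈ (Finset.univ : Finset (Fin t))) => (h2 l).2
        simp at this
        push_cast
        nlinarith [h1.2]
    intro u hu u' hu' j
    have h1 := key u hu j
    have h2 := key u' hu' j
    have : (((t + 1) * r * X ^ k : ℕ) : ℤ) < M := by exact_mod_cast hM
    rw [abs_lt]; constructor <;> linarith [h1.1, h1.2, h2.1, h2.2]

end


noncomputable def fwc (X p b : ℕ) (η : ℤ) : Finset ℤ :=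
  (Finset.Icc 1 (X : ℤ)).filter (fun x => (p : ℤ) ^ b ∣ x - η)

noncomputable def fwCl (p a b : ℕ) (ξ : ℤ) : Finset ℤ :=
  (Finset.Ico 0 ((p : ℤ) ^ b)).filter (fun z => (p : ℤ) ^ a ∣ z - ξ)

open Classical in
noncomputable def fwT (r X p b : ℕ) (η : ℤ) : Finset (Fin r → ℤ) :=
  (Fintype.piFinset fun _ : Fin r => fwc X p b η).filter
    (fun x => StrictMono fun i => x i % (p : ℤ) ^ (b + 1))

lemma fw_mem_fwc {X p b : ℕ} {η x : ℤ} :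
    x ∈ fwc X p b η ↔ (1 ≤ x ∧ x ≤ X) ∧ (p : ℤ) ^ b ∣ x - η := by
  simp [fwc]

lemma fw_mem_fwCl {p a b : ℕ} {ξ z : ℤ} :
    z ∈ fwCl p a b ξ ↔ (0 ≤ z ∧ z < (p : ℤ) ^ b) ∧ (p : ℤ) ^ a ∣ z - ξ := by
  simp [fwCl]

lemma fw_mem_fwT {r X p b : ℕ} {η : ℤ} {x : Fin r → ℤ} :
    x ∈ fwT r X p b η ↔ (∀ i, x i ∈ fwc X p b η) ∧ StrictMono fun i => x i % (p : ℤ) ^ (b + 1) := by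
  simp [fwT]

lemma fw_card_Cl {p a b : ℕ} (hp : 1 ≤ p) (hab : a ≤ b) (ξ : ℤ) :
    (fwCl p a b ξ).card ≤ p ^ (b - a) := by
  have hpa : (0 : ℤ) < (p : ℤ) ^ a := by positivity
  have h : (fwCl p a b ξ).card ≤ (Finset.Ico (0 : ℤ) ((p : ℤ) ^ (b - a))).card := by
    refine Finset.card_le_card_of_injOn (fun z => z / (p : ℤ) ^ a) ?_ ?_
    · intro z hz
      have hz := fw_mem_fwCl.mp hz
      simp only [Finset.coe_Ico, Set.mem_Ico]
      refine ⟨Int.ediv_nonneg hz.1.1 hpa.le, ?_⟩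
      rw [Int.ediv_lt_iff_lt_mul hpa, ← pow_add, Nat.sub_add_cancel hab]
      exact hz.1.2
    · intro z hz z' hz' h
      have hz := (fw_mem_fwCl.mp hz).2
      have hz' := (fw_mem_fwCl.mp hz').2
      have h1 : z % (p : ℤ) ^ a = z' % (p : ℤ) ^ a := by
        rw [(Int.emod_emod_of_dvd z dvd_rfl).symm]
        exact Int.ModEq.trans (b := ξ) (by
          simpa [Int.ModEq] using ((Int.modEq_iff_dvd.mpr hz).symm : Int.ModEq _ z ξ))
          (Int.modEq_iff_dvd.mpr hz')
      simp only at h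
      rw [← Int.emod_add_mul_ediv z ((p : ℤ) ^ a), ← Int.emod_add_mul_ediv z' ((p : ℤ) ^ a), h1, h]
  have h2 := h
  simp at h2
  exact_mod_cast h2

lemma fw_emod_mem {X p b b1 : ℕ} (hp : 1 ≤ p) (hb : b ≤ b1) {η x : ℤ} (hx : x ∈ fwc X p b η) :
    x % (p : ℤ) ^ b1 ∈ fwCl p b b1 η := by
  have hpa : (0 : ℤ) < (p : ℤ) ^ b1 := by positivity
  rw [fw_mem_fwCl]
  refine ⟨⟨Int.emod_nonneg _ hpa.ne', Int.emod_lt_of_pos _ hpa⟩, ?_⟩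
  have h1 := (fw_mem_fwc.mp hx).2
  have h2 : (p : ℤ) ^ b1 ∣ x % (p : ℤ) ^ b1 - x := by
    rw [← Int.modEq_iff_dvd]; exact (Int.mod_modEq x _).symm
  have h3 := dvd_add ((pow_dvd_pow (p : ℤ) hb).trans h2) h1
  simpa using h3

lemma fw_fiber {X p b b1 : ℕ} (hb : b ≤ b1) {η z : ℤ} (hz : z ∈ fwCl p b b1 η) :
    (fwc X p b η).filter (fun x => x % (p : ℤ) ^ b1 = z) = fwc X p b1 z := by
  ext x
  have hz := fw_mem_fwCl.mp hz
  simp only [Finset.mem_filter, fw_mem_fwc]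
  have hzz : z % (p : ℤ) ^ b1 = z := Int.emod_eq_of_lt hz.1.1 hz.1.2
  have e : x % (p : ℤ) ^ b1 = z ↔ (p : ℤ) ^ b1 ∣ x - z := by
    constructor
    · intro h
      have h1 : (p : ℤ) ^ b1 ∣ x - x % (p : ℤ) ^ b1 := by
        rw [← Int.modEq_iff_dvd]; exact Int.mod_modEq x _
      rwa [h] at h1
    · intro h
      rw [← hzz]
      exact (Int.modEq_iff_dvd.mpr h).symm
  constructor
  · rintro ⟨⟨h1, h2⟩, h3⟩
    exact ⟨h1, e.mp h3⟩
  · rintro ⟨h1, h3⟩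
    refine ⟨⟨h1, ?_⟩, e.mpr h3⟩
    have := dvd_add ((pow_dvd_pow (p : ℤ) hb).trans h3) hz.2
    simpa using this

section
variable {k M : ℕ} [NeZero M]

lemma fwf_split {X p b b1 : ℕ} (hp : 1 ≤ p) (hb : b ≤ b1) (η : ℤ) (α : Fin k → ZMod M) :
    fwf (fwc X p b η) α = ∑ z ∈ fwCl p b b1 η, fwf (fwc X p b1 z) α := by
  unfold fwf
  rw [← Finset.sum_fiberwise_of_maps_to (fun x hx => fw_emod_mem (b1 := b1) hp hb hx)]
  refine Finset.sum_congr rfl fun z hz => ?_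
  rw [fw_fiber hb hz]

lemma fwS_T {r X p b : ℕ} (hp : 1 ≤ p) (η : ℤ) (α : Fin k → ZMod M) :
    fwS (fwT r X p b η) α = ∑ g ∈ (Fintype.piFinset (fun _ : Fin r => fwCl p b (b+1) η)).filter
      (fun g => StrictMono g), ∏ i, fwf (fwc X p (b+1) (g i)) α := by
  classical
  simp_rw [← fwS_pi]
  unfold fwS
  rw [← Finset.sum_fiberwise_of_maps_to (s := fwT r X p b η)
    (t := (Fintype.piFinset (fun _ : Fin r => fwCl p b (b+1) η)).filter (fun g => StrictMono g))
    (g := fun x i => x i % (p : ℤ) ^ (b+1))]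
  · refine Finset.sum_congr rfl fun g hg => ?_
    refine Finset.sum_congr ?_ fun _ _ => rfl
    simp only [Finset.mem_filter, Fintype.mem_piFinset] at hg
    ext x
    simp only [Finset.mem_filter, fw_mem_fwT, Fintype.mem_piFinset]
    constructor
    · rintro ⟨⟨h1, h2⟩, rfl⟩ i
      rw [← fw_fiber (X := X) (Nat.le_succ b) (hg.1 i)]
      simp [h1 i]
    · intro h
      have h' : ∀ i, x i ∈ fwc X p b η ∧ x i % (p : ℤ) ^ (b+1) = g i := fun i => by
        have := h i
        rw [← fw_fiber (X := X) (Nat.le_succ b) (hg.1 i)] at this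
        simpa using this
      have e : (fun i => x i % (p : ℤ) ^ (b+1)) = g := funext fun i => (h' i).2
      exact ⟨⟨fun i => (h' i).1, e ▸ hg.2⟩, e⟩
  · intro x hx
    rw [fw_mem_fwT] at hx
    simp only [Finset.mem_filter, Fintype.mem_piFinset]
    exact ⟨fun i => fw_emod_mem hp (Nat.le_succ b) (hx.1 i), hx.2⟩

end

lemma fw_shift {ι : Type*} [Fintype ι] (x y : ι → ℤ) (k : ℕ)
    (h : ∀ j, 1 ≤ j → j ≤ k → ∑ i, x i ^ j = ∑ i, y i ^ j) (c : ℤ) (j : ℕ) (hj : j ≤ k) :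
    ∑ i, (x i - c) ^ j = ∑ i, (y i - c) ^ j := by
  simp_rw [sub_eq_add_neg, add_pow]
  rw [Finset.sum_comm, Finset.sum_comm (s := Finset.univ)]
  refine Finset.sum_congr rfl fun m hm => ?_
  rw [← Finset.sum_mul, ← Finset.sum_mul, ← Finset.sum_mul, ← Finset.sum_mul]
  congr 2
  rcases Nat.eq_zero_or_pos m with rfl | h0
  · simp
  · exact h m h0 (by simp at hm; omega)

lemma fw_comb {τ β γ : Type*} [DecidableEq τ] [DecidableEq β] [DecidableEq γ] (U : Finset τ)
    (V : τ → β) (c : τ → γ) (D : ℕ)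
    (h : ∀ u ∈ U, ∃ S : Finset γ, S.card ≤ D ∧ ∀ u' ∈ U, V u = V u' → c u' ∈ S) :
    ((U ×ˢ U).filter (fun q => V q.1 = V q.2)).card ≤
      D * ((U ×ˢ U).filter (fun q => V q.1 = V q.2 ∧ c q.1 = c q.2)).card := by
  have key : ∀ (δ : Type _) [DecidableEq δ] (W : τ → δ),
      ((U ×ˢ U).filter (fun q => W q.1 = W q.2)).card
        = ∑ v ∈ U.image W, (U.filter (fun u => W u = v)).card ^ 2 := by
    intro δ _ W
    rw [Finset.card_eq_sum_card_fiberwise (f := fun q => W q.1) (t := U.image W)]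
    · refine Finset.sum_congr rfl fun v _ => ?_
      rw [sq, ← Finset.card_product]
      congr 1
      ext q
      simp only [Finset.mem_filter, Finset.mem_product]
      constructor
      · rintro ⟨⟨⟨h1, h2⟩, h3⟩, h4⟩; exact ⟨⟨h1, h4⟩, h2, h3 ▸ h4⟩
      · rintro ⟨⟨h1, h4⟩, h2, h3⟩; exact ⟨⟨⟨h1, h2⟩, h4.trans h3.symm⟩, h4⟩
    · intro q hq
      simp only [Finset.coe_filter, Finset.mem_product, Set.mem_ofPred_eq] at hq
      simp only [Finset.coe_image, Set.mem_image, Finset.mem_coe]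
      exact ⟨q.1, hq.1.1, rfl⟩
  have h2 : ((U ×ˢ U).filter (fun q => V q.1 = V q.2 ∧ c q.1 = c q.2)).card =
      ∑ v ∈ U.image V, ∑ z ∈ (U.filter (fun u => V u = v)).image c,
        ((U.filter (fun u => V u = v)).filter (fun u => c u = z)).card ^ 2 := by
    rw [Finset.card_eq_sum_card_fiberwise (f := fun q => V q.1) (t := U.image V)]
    · refine Finset.sum_congr rfl fun v _ => ?_
      rw [Finset.card_eq_sum_card_fiberwise (f := fun q => c q.1)
        (t := (U.filter (fun u => V u = v)).image c)]
      · refine Finset.sum_congr rfl fun z _ => ?_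
        rw [sq, ← Finset.card_product]
        congr 1
        ext q
        simp only [Finset.mem_filter, Finset.mem_product]
        constructor
        · rintro ⟨⟨⟨⟨h1, h2⟩, h3, h5⟩, h4⟩, h6⟩
          exact ⟨⟨⟨h1, h4⟩, h6⟩, ⟨h2, h3 ▸ h4⟩, h5 ▸ h6⟩
        · rintro ⟨⟨⟨h1, h4⟩, h6⟩, ⟨h2, h3⟩, h5⟩
          exact ⟨⟨⟨⟨h1, h2⟩, h4.trans h3.symm, h6.trans h5.symm⟩, h4⟩, h6⟩
      · intro q hq
        simp only [Finset.coe_filter, Finset.mem_filter, Finset.mem_product,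
          Set.mem_ofPred_eq] at hq
        simp only [Finset.coe_image, Set.mem_image, Finset.mem_coe, Finset.mem_filter]
        exact ⟨q.1, ⟨hq.1.1.1, hq.2⟩, rfl⟩
    · intro q hq
      simp only [Finset.coe_filter, Finset.mem_product, Set.mem_ofPred_eq] at hq
      simp only [Finset.coe_image, Set.mem_image, Finset.mem_coe]
      exact ⟨q.1, hq.1.1, rfl⟩
  rw [key β V, h2, Finset.mul_sum]
  refine Finset.sum_le_sum fun v hv => ?_
  obtain ⟨u, hu, rfl⟩ := Finset.mem_image.mp hv
  set Uv := U.filter (fun u' => V u' = V u) with hUv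
  have hc : (Uv.image c).card ≤ D := by
    obtain ⟨S, hS, hS2⟩ := h u hu
    refine (Finset.card_le_card ?_).trans hS
    intro z hz
    obtain ⟨u', hu', rfl⟩ := Finset.mem_image.mp hz
    rw [hUv, Finset.mem_filter] at hu'
    exact hS2 u' hu'.1 hu'.2.symm
  rw [Finset.card_eq_sum_card_image c Uv]
  calc (∑ b ∈ Uv.image c, (Uv.filter (fun u => c u = b)).card) ^ 2
      ≤ (Uv.image c).card * ∑ b ∈ Uv.image c, (Uv.filter (fun u => c u = b)).card ^ 2 :=
        sq_sum_le_card_mul_sum_sq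
    _ ≤ _ := Nat.mul_le_mul_right _ hc


lemma fw_J_finite (s k N : ℕ) : {p : (Fin s → ℤ) × (Fin s → ℤ) |
    (∀ i, 1 ≤ p.1 i ∧ (p.1 i : ℝ) ≤ (N : ℝ)) ∧ (∀ i, 1 ≤ p.2 i ∧ (p.2 i : ℝ) ≤ (N : ℝ)) ∧
    ∀ j ∈ Finset.Icc 1 k, ∑ i, p.1 i ^ j = ∑ i, p.2 i ^ j}.Finite := by
  refine Set.Finite.subset (Finset.finite_toSet
    ((Fintype.piFinset fun _ : Fin s => Finset.Icc (1 : ℤ) N) ×ˢ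
      (Fintype.piFinset fun _ : Fin s => Finset.Icc (1 : ℤ) N))) ?_
  rintro ⟨x, y⟩ ⟨h1, h2, -⟩
  simp only [Finset.coe_product, Set.mem_prod, Finset.mem_coe, Fintype.mem_piFinset,
    Finset.mem_Icc]
  exact ⟨fun i => ⟨(h1 i).1, by exact_mod_cast (h1 i).2⟩,
    fun i => ⟨(h2 i).1, by exact_mod_cast (h2 i).2⟩⟩

section
variable {k M : ℕ} [NeZero M]

lemma fw_J_le {s X : ℕ} (hM : s * X ^ k < M) :
    (J s k (X : ℝ) : ℝ) ≤ fwX (fun α : Fin k → ZMod M => ‖fwf (Finset.Icc 1 (X : ℤ)) α‖ ^ (2 * s)) := by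
  classical
  have h1 : ∀ α : Fin k → ZMod M, ‖fwf (Finset.Icc 1 (X : ℤ)) α‖ ^ (2 * s) =
      ‖∑ u ∈ Fintype.piFinset (fun _ : Fin s => Finset.Icc 1 (X : ℤ)), fwE α (fwp k u)‖ ^ 2 := by
    intro α
    have := fwS_pi (fun _ : Fin s => Finset.Icc 1 (X : ℤ)) α
    unfold fwS at this
    rw [this]
    simp [← pow_mul, mul_comm]
  simp_rw [h1]
  rw [fw_count]
  · rw [← Set.ncard_coe_finset]
    unfold J
    refine Nat.cast_le.mpr (Set.ncard_le_ncard ?_ (Finset.finite_toSet _))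
    rintro ⟨x, y⟩ ⟨h1, h2, h3⟩
    simp only [Finset.coe_filter, Finset.mem_product, Fintype.mem_piFinset,
      Finset.mem_Icc, Set.mem_ofPred_eq]
    refine ⟨⟨fun i => ⟨(h1 i).1, by exact_mod_cast (h1 i).2⟩,
      fun i => ⟨(h2 i).1, by exact_mod_cast (h2 i).2⟩⟩, ?_⟩
    funext j
    exact h3 _ (by simp)
  · intro u hu u' hu' j
    simp only [Fintype.mem_piFinset, Finset.mem_Icc] at hu hu'
    have h1 := fwp_bound (k := k) u hu j
    have h2 := fwp_bound (k := k) u' hu' j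
    have : ((s * X ^ k : ℕ) : ℤ) < M := by exact_mod_cast hM
    push_cast at this
    rw [abs_lt]; constructor <;> linarith [h1.1, h1.2, h2.1, h2.2]

lemma fw_C1 {r t X p b : ℕ} (hp : 1 ≤ p) (hM : (t + 1) * r * X ^ k < M) (η : ℤ)
    (T : Finset (Fin r → ℤ)) (hT : ∀ x ∈ T, ∀ i, x i ∈ fwc X p b η) :
    fwX (fun α : Fin k → ZMod M => ‖fwS T α‖ ^ (2 * (t + 1)))
      ≤ J ((t + 1) * r) k ((X / p ^ b + 1 : ℕ) : ℝ) := by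
  classical
  have hpb : (0 : ℤ) < (p : ℤ) ^ b := by positivity
  have hT' : ∀ x ∈ T, ∀ i, 1 ≤ x i ∧ x i ≤ X := fun x hx i => (fw_mem_fwc.mp (hT x hx i)).1
  have h1 : ∀ α : Fin k → ZMod M, ‖fwS T α‖ ^ (2 * (t + 1)) = ‖fwS T α‖ ^ 2 * ‖fwS T α‖ ^ (2 * t) :=
    fun α => by ring
  simp_rw [h1]
  rw [fw_mv hM T T hT' hT']
  norm_cast
  rw [← Set.ncard_coe_finset]
  unfold J
  let ψ : (Fin r → ℤ) × (Fin t → Fin r → ℤ) → Fin ((t + 1) * r) → ℤ := fun u q =>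
    (Fin.cons u.1 u.2 : Fin (t + 1) → Fin r → ℤ) (finProdFinEquiv.symm q).1
      (finProdFinEquiv.symm q).2
  have hψmem : ∀ u ∈ T ×ˢ Fintype.piFinset (fun _ : Fin t => T), ∀ q, ψ u q ∈ fwc X p b η := by
    intro u hu q
    simp only [Finset.mem_product, Fintype.mem_piFinset] at hu
    have : ∀ l : Fin (t + 1), (Fin.cons u.1 u.2 : Fin (t + 1) → Fin r → ℤ) l ∈ T := by
      intro l
      refine Fin.cases ?_ (fun l => ?_) l
      · simpa using hu.1
      · simpa using hu.2 l
    exact hT _ (this _) _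
  have hψsum : ∀ u (j : Fin k), ∑ q, ψ u q ^ ((j : ℕ) + 1) = (fwp k u.1 + ∑ l, fwp k (u.2 l)) j := by
    intro u j
    rw [← finProdFinEquiv.sum_comp, Fintype.sum_prod_type]
    simp only [ψ, Equiv.symm_apply_apply]
    rw [Fin.sum_univ_succ]
    simp [fwp]
  have hmod : ∀ x ∈ fwc X p b η, x - η % (p : ℤ) ^ b = (p : ℤ) ^ b * (x / (p : ℤ) ^ b) := by
    intro x hx
    have h2 : x % (p : ℤ) ^ b = η % (p : ℤ) ^ b :=
      (Int.modEq_iff_dvd.mpr (fw_mem_fwc.mp hx).2).symm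
    have := Int.emod_add_mul_ediv x ((p : ℤ) ^ b)
    rw [← h2]; linarith
  refine Set.ncard_le_ncard_of_injOn
    (fun q => (fun i => ψ q.1 i / (p : ℤ) ^ b + 1, fun i => ψ q.2 i / (p : ℤ) ^ b + 1)) ?_ ?_
    (fw_J_finite _ _ _)
  · rintro ⟨u, u'⟩ hq
    simp only [Finset.coe_filter, Set.mem_ofPred_eq, Finset.mem_product (s := T ×ˢ _)] at hq
    obtain ⟨⟨hu, hu'⟩, hE⟩ := hq
    have hbd : ∀ x ∈ fwc X p b η, 1 ≤ x / (p : ℤ) ^ b + 1 ∧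
        ((x / (p : ℤ) ^ b + 1 : ℤ) : ℝ) ≤ ((X / p ^ b + 1 : ℕ) : ℝ) := by
      intro x hx
      have hx := (fw_mem_fwc.mp hx).1
      have h3 : 0 ≤ x / (p : ℤ) ^ b := Int.ediv_nonneg (by linarith) hpb.le
      have h4 : x / (p : ℤ) ^ b ≤ (X : ℤ) / (p : ℤ) ^ b := Int.ediv_le_ediv hpb hx.2
      refine ⟨by linarith, ?_⟩
      have h5 : x / (p : ℤ) ^ b + 1 ≤ ((X / p ^ b + 1 : ℕ) : ℤ) := by
        push_cast; linarith
      have h6 := (Int.cast_le (R := ℝ)).mpr h5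
      rwa [Int.cast_natCast] at h6
    refine ⟨fun i => hbd _ (hψmem u hu i), fun i => hbd _ (hψmem u' hu' i), ?_⟩
    have hs : ∀ j, 1 ≤ j → j ≤ k → ∑ i, ψ u i ^ j = ∑ i, ψ u' i ^ j := by
      intro j hj1 hjk
      have e1 := hψsum u ⟨j - 1, by omega⟩
      have e2 := hψsum u' ⟨j - 1, by omega⟩
      simp only [Nat.sub_add_cancel hj1] at e1 e2
      rw [e1, e2, hE]
    have hs2 := fw_shift _ _ k hs (η % (p : ℤ) ^ b)
    have hs3 : ∀ j, 1 ≤ j → j ≤ k → ∑ i, (ψ u i / (p : ℤ) ^ b) ^ j = ∑ i, (ψ u' i / (p : ℤ) ^ b) ^ j := by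
      intro j _ hjk
      have h5 := hs2 j hjk
      simp_rw [fun i => hmod _ (hψmem u hu i), fun i => hmod _ (hψmem u' hu' i), mul_pow] at h5
      rw [← Finset.mul_sum, ← Finset.mul_sum] at h5
      exact mul_left_cancel₀ (pow_ne_zero _ hpb.ne') h5
    intro j hj
    have := fw_shift _ _ k hs3 (-1) j (Finset.mem_Icc.mp hj).2
    simpa using this
  · rintro ⟨u1, u2⟩ hq ⟨v1, v2⟩ hq' he
    simp only [Finset.coe_filter, Set.mem_ofPred_eq, Finset.mem_product (s := T ×ˢ _)] at hq hq'
    have hinj : ∀ u ∈ T ×ˢ Fintype.piFinset (fun _ : Fin t => T),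
        ∀ v ∈ T ×ˢ Fintype.piFinset (fun _ : Fin t => T),
        (fun i => ψ u i / (p : ℤ) ^ b + 1) = (fun i => ψ v i / (p : ℤ) ^ b + 1) → u = v := by
      intro u hu v hv h
      have h6 : ψ u = ψ v := by
        funext i
        have h7 := congrFun h i
        have h8 := hmod _ (hψmem u hu i)
        have h9 := hmod _ (hψmem v hv i)
        simp only [add_left_inj] at h7
        rw [h7] at h8
        linarith
      have h10 : (Fin.cons u.1 u.2 : Fin (t + 1) → Fin r → ℤ) = Fin.cons v.1 v.2 := by
        funext l i
        have := congrFun h6 (finProdFinEquiv (l, i))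
        simpa only [ψ, Equiv.symm_apply_apply] using this
      have := Fin.cons_inj.mp h10
      exact Prod.ext this.1 this.2
    simp only [Prod.mk.injEq] at he
    rw [hinj u1 hq.1.1 v1 hq'.1.1 he.1, hinj u2 hq.1.2 v2 hq'.1.2 he.2]

end

lemma fw_prod_le {r : ℕ} (hr : 1 ≤ r) (x : Fin r → ℝ) (hx : ∀ i, 0 ≤ x i) :
    ∏ i, x i ≤ ∑ i, x i ^ r := by
  have : (Finset.univ : Finset (Fin r)).Nonempty := ⟨⟨0, hr⟩, Finset.mem_univ _⟩
  obtain ⟨m, -, hm⟩ := Finset.exists_max_image Finset.univ x this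
  calc ∏ i, x i ≤ ∏ _i : Fin r, x m := Finset.prod_le_prod (fun i _ => hx i) (fun i hi => hm i hi)
    _ = x m ^ r := by simp
    _ ≤ _ := Finset.single_le_sum (f := fun i => x i ^ r) (fun i _ => pow_nonneg (hx i) _)
        (Finset.mem_univ m)

lemma fw_fib {τ γ : Type*} [DecidableEq τ] [DecidableEq γ] (F : Finset τ) (f : τ → γ)
    (T : Finset γ) (B : ℝ) (hm : ∀ q ∈ F, f q ∈ T)
    (h : ∀ z ∈ T, ((F.filter (fun q => f q = z)).card : ℝ) ≤ B) :
    (F.card : ℝ) ≤ T.card * B := by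
  rw [Finset.card_eq_sum_card_fiberwise (f := f) (t := T) hm]
  push_cast
  calc _ ≤ ∑ _z ∈ T, B := Finset.sum_le_sum h
    _ = _ := by simp

section
variable {M : ℕ} [NeZero M]

set_option maxHeartbeats 1000000 in
lemma fw_S2 {r t X p a b b' : ℕ} (hp : p.Prime) (hk : r + t < p) (hr1 : 1 ≤ r) (hr : r ≤ t + 1)
    (ha : 1 ≤ a) (hab : a < b) (hb' : b' + t * a = (t + 1) * b)
    (hM : (t + 1) * r * X ^ (r + t) < M)
    (ξ η : ℤ) (hξη : ¬ (p : ℤ) ∣ ξ - η) (B : ℝ)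
    (hB : ∀ ξ', (p : ℤ) ^ a ∣ ξ' - ξ → fwX (fun α : Fin (r + t) → ZMod M =>
      ‖fwf (fwc X p b' ξ') α‖ ^ (2 * r) * ‖fwS (fwT r X p b η) α‖ ^ (2 * t)) ≤ B) :
    fwX (fun α : Fin (r + t) → ZMod M =>
      ‖fwS (fwT r X p a ξ) α‖ ^ 2 * ‖fwS (fwT r X p b η) α‖ ^ (2 * t))
      ≤ r ^ (r + 1) * (p : ℝ) ^ (r * (b' - a)) * B := by
  classical
  have hp1 : 1 ≤ p := hp.one_lt.le
  have hab' : a ≤ b' := by nlinarith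
  have hB0 : 0 ≤ B := le_trans (fwX_nonneg fun α => by positivity) (hB ξ (by simp))
  set Q := fwT r X p a ξ with hQ
  set R := fwT r X p b η with hR
  have hQb : ∀ x ∈ Q, ∀ i, 1 ≤ x i ∧ x i ≤ X := fun x hx i =>
    (fw_mem_fwc.mp ((fw_mem_fwT.mp hx).1 i)).1
  have hRb : ∀ x ∈ R, ∀ i, 1 ≤ x i ∧ x i ≤ X := fun x hx i =>
    (fw_mem_fwc.mp ((fw_mem_fwT.mp hx).1 i)).1
  rw [fw_mv hM Q R hQb hRb]
  set U := Q ×ˢ Fintype.piFinset (fun _ : Fin t => R) with hU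
  let V : (Fin r → ℤ) × (Fin t → Fin r → ℤ) → Fin (r + t) → ℤ := fun u =>
    fwp (r + t) u.1 + ∑ l, fwp (r + t) (u.2 l)
  let c : (Fin r → ℤ) × (Fin t → Fin r → ℤ) → Fin r → ℤ := fun u i => u.1 i % (p : ℤ) ^ b'
  have hcong : ∀ u ∈ U, ∀ u' ∈ U, V u = V u' → ∀ j, ∃ i, c u' j = c u i := by
    intro u hu u' hu' hV j
    simp only [hU, Finset.mem_product, Fintype.mem_piFinset] at hu hu'
    have hs : ∀ j, 1 ≤ j → j ≤ r + t →
        ∑ q, (Sum.elim u.1 (fun q : Fin t × Fin r => u.2 q.1 q.2)) q ^ j =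
        ∑ q, (Sum.elim u'.1 (fun q : Fin t × Fin r => u'.2 q.1 q.2)) q ^ j := by
      intro j hj1 hjk
      have e := congrFun hV ⟨j - 1, by omega⟩
      simp only [V, fwp, Pi.add_apply, Finset.sum_apply, Nat.sub_add_cancel hj1] at e
      simpa [Fintype.sum_sum_type, Fintype.sum_prod_type] using e
    have hs2 := fw_shift _ _ _ hs η
    have hw : ∀ (w : Fin t → Fin r → ℤ), (∀ l, w l ∈ R) → ∀ j, t + 1 ≤ j →
        (p : ℤ) ^ ((t + 1) * b) ∣ ∑ l, ∑ i, (w l i - η) ^ j := by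
      intro w hw j hj
      refine Finset.dvd_sum fun l _ => Finset.dvd_sum fun i _ => ?_
      have h1 := (fw_mem_fwc.mp ((fw_mem_fwT.mp (hw l)).1 i)).2
      have h2 := pow_dvd_pow_of_dvd h1 j
      rw [← pow_mul] at h2
      refine (pow_dvd_pow _ ?_).trans h2
      nlinarith
    have hxc : ∀ x ∈ Q, ∀ i, (p : ℤ) ^ a ∣ x i - ξ := fun x hx i =>
      (fw_mem_fwc.mp ((fw_mem_fwT.mp hx).1 i)).2
    obtain ⟨i, hi⟩ := fw_cong hp (r := r) (t := t) hk (a := a) (b' := b') (m := (t + 1) * b) ha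
      (ξ - η) hξη (fun i => u.1 i - η) (fun i => u'.1 i - η)
      (fun i => by simpa using hxc _ hu.1 i) (fun i => by simpa using hxc _ hu'.1 i)
      (fun i j hij hd => by
        have h3 := (fw_mem_fwT.mp hu.1).2.injective.ne hij
        apply h3
        have h4 : (p : ℤ) ^ (a + 1) ∣ u.1 i - u.1 j := by simpa using hd
        exact (Int.modEq_iff_dvd.mpr h4).symm)
      (fun j hj1 hj2 => by
        have h5 := hs2 j (by omega)
        simp only [Fintype.sum_sum_type, Fintype.sum_prod_type, Sum.elim_inl, Sum.elim_inr] at h5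
        have h6 := dvd_sub (hw u'.2 hu'.2 j hj1) (hw u.2 hu.2 j hj1)
        have h7 : ∑ i, (u.1 i - η) ^ j - ∑ i, (u'.1 i - η) ^ j =
          ∑ l, ∑ i, (u'.2 l i - η) ^ j - ∑ l, ∑ i, (u.2 l i - η) ^ j := by linarith
        rw [h7]; exact h6)
      (by nlinarith) j
    refine ⟨i, ?_⟩
    have h8 : (p : ℤ) ^ b' ∣ u'.1 j - u.1 i := by simpa using hi
    exact (Int.modEq_iff_dvd.mpr h8).symm
  have hcomb := fw_comb U V c (r ^ r) (by
    intro u hu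
    refine ⟨Fintype.piFinset (fun _ : Fin r => Finset.univ.image (c u)), ?_, ?_⟩
    · rw [Fintype.card_piFinset]
      simp only [Finset.prod_const, Finset.card_univ, Fintype.card_fin]
      refine Nat.pow_le_pow_left ?_ r
      simpa using Finset.card_image_le (s := (Finset.univ : Finset (Fin r))) (f := c u)
    · intro u' hu' h
      simp only [Fintype.mem_piFinset, Finset.mem_image, Finset.mem_univ, true_and]
      intro j
      obtain ⟨i, hi⟩ := hcong u hu u' hu' h j
      exact ⟨i, hi.symm⟩)
  have hz : (((U ×ˢ U).filter (fun q => V q.1 = V q.2 ∧ c q.1 = c q.2)).card : ℝ)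
      ≤ (p : ℝ) ^ (r * (b' - a)) * (r * B) := by
    have hmaps : ∀ q ∈ (U ×ˢ U).filter (fun q => V q.1 = V q.2 ∧ c q.1 = c q.2),
        c q.1 ∈ Fintype.piFinset (fun _ : Fin r => fwCl p a b' ξ) := by
      intro q hq
      simp only [hU, Finset.mem_filter, Finset.mem_product (s := Q ×ˢ _)] at hq
      simp only [Fintype.mem_piFinset]
      intro i
      exact fw_emod_mem hp1 hab' ((fw_mem_fwT.mp (Finset.mem_product.mp hq.1.1).1).1 i)
    have hone : ∀ z ∈ Fintype.piFinset (fun _ : Fin r => fwCl p a b' ξ),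
        ((((U ×ˢ U).filter (fun q => V q.1 = V q.2 ∧ c q.1 = c q.2)).filter
          (fun q => c q.1 = z)).card : ℝ) ≤ r * B := by
      intro z hz
      simp only [Fintype.mem_piFinset] at hz
      set Qz := Fintype.piFinset (fun i : Fin r => fwc X p b' (z i)) with hQz
      have hsub : ∀ u ∈ U, c u = z → u ∈ Qz ×ˢ Fintype.piFinset (fun _ : Fin t => R) := by
        intro u hu hc
        simp only [hU, Finset.mem_product] at hu
        refine Finset.mem_product.mpr ⟨?_, hu.2⟩
        simp only [hQz, Fintype.mem_piFinset]
        intro i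
        rw [← fw_fiber (X := X) hab' (hz i), Finset.mem_filter]
        exact ⟨(fw_mem_fwT.mp hu.1).1 i, congrFun hc i⟩
      have h1 := fw_mv (k := r + t) (M := M) hM Qz R (fun x hx i => by
        simp only [hQz, Fintype.mem_piFinset] at hx
        exact (fw_mem_fwc.mp (hx i)).1) hRb
      calc _ ≤ _ := Nat.cast_le.mpr (Finset.card_le_card ?_)
        _ = _ := h1.symm
        _ ≤ fwX (fun α : Fin (r + t) → ZMod M => ∑ i, ‖fwf (fwc X p b' (z i)) α‖ ^ (2 * r)
              * ‖fwS R α‖ ^ (2 * t)) := by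
            refine fwX_mono fun α => ?_
            rw [hQz, fwS_pi, norm_prod, ← Finset.prod_pow, ← Finset.sum_mul]
            gcongr
            refine (fw_prod_le hr1 _ fun i => by positivity).trans (le_of_eq ?_)
            simp [← pow_mul]
        _ ≤ ∑ _i : Fin r, B := by
            rw [fwX_sum]
            exact Finset.sum_le_sum fun i _ => hB _ (fw_mem_fwCl.mp (hz i)).2
        _ = r * B := by simp
      intro q hq
      simp only [Finset.mem_filter, Finset.mem_product (s := U)] at hq
      simp only [Finset.mem_filter, Finset.mem_product (s := Qz ×ˢ _)]
      obtain ⟨⟨⟨h1, h2⟩, h3, h4⟩, h5⟩ := hq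
      exact ⟨⟨hsub _ h1 h5, hsub _ h2 (h4 ▸ h5)⟩, h3⟩
    have hfib := fw_fib _ (fun q : ((Fin r → ℤ) × (Fin t → Fin r → ℤ)) ×
      ((Fin r → ℤ) × (Fin t → Fin r → ℤ)) => c q.1) _ _ hmaps hone
    calc _ ≤ _ := hfib
      _ = ((fwCl p a b' ξ).card : ℝ) ^ r * (r * B) := by
          simp [Fintype.card_piFinset]
      _ ≤ ((p : ℝ) ^ (b' - a)) ^ r * (r * B) := by
          gcongr
          exact_mod_cast fw_card_Cl hp1 hab' ξ
      _ = _ := by rw [← pow_mul, mul_comm (b' - a) r]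
  calc _ ≤ ((r ^ r * ((U ×ˢ U).filter (fun q => V q.1 = V q.2 ∧ c q.1 = c q.2)).card : ℕ) : ℝ) :=
        Nat.cast_le.mpr hcomb
    _ ≤ (r : ℝ) ^ r * ((p : ℝ) ^ (r * (b' - a)) * (r * B)) := by
        push_cast
        gcongr
    _ = _ := by ring

end


lemma fw_holder0 {ι : Type*} (s : Finset ι) (w u v : ι → ℝ) (n : ℕ) (hw : ∀ i ∈ s, 0 ≤ w i)
    (hu : ∀ i ∈ s, 0 ≤ u i) (hv : ∀ i ∈ s, 0 ≤ v i) :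
    (∑ i ∈ s, w i * u i * v i ^ n) ^ (n + 1) ≤
      (∑ i ∈ s, w i * u i ^ (n + 1)) * (∑ i ∈ s, w i * v i ^ (n + 1)) ^ n := by
  rcases Nat.eq_zero_or_pos n with rfl | hn
  · simp
  have hn' : (0 : ℝ) < n := by exact_mod_cast hn
  set P : ℝ := n + 1 with hP
  set q : ℝ := (n + 1) / n with hq
  have hP0 : 0 < P := by positivity
  have hq0 : 0 < q := by positivity
  have hpq : P.HolderConjugate q := by
    rw [Real.holderConjugate_iff]
    refine ⟨by rw [hP]; linarith, ?_⟩
    rw [hP, hq]; field_simp; ring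
  have h := Real.inner_le_Lp_mul_Lq_of_nonneg s hpq (f := fun i => (w i) ^ (1 / P) * u i)
    (g := fun i => (w i) ^ (1 / q) * v i ^ n)
    (fun i hi => mul_nonneg (Real.rpow_nonneg (hw i hi) _) (hu i hi))
    (fun i hi => mul_nonneg (Real.rpow_nonneg (hw i hi) _) (pow_nonneg (hv i hi) _))
  have e1 : ∀ i ∈ s, (w i) ^ (1 / P) * u i * ((w i) ^ (1 / q) * v i ^ n) = w i * u i * v i ^ n := by
    intro i hi
    have : (w i) ^ (1 / P) * (w i) ^ (1 / q) = w i := by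
      rw [← Real.rpow_add_of_nonneg (hw i hi) (by positivity) (by positivity)]
      have : 1 / P + 1 / q = 1 := by rw [hP, hq]; field_simp; ring
      rw [this, Real.rpow_one]
    calc _ = ((w i) ^ (1 / P) * (w i) ^ (1 / q)) * u i * v i ^ n := by ring
      _ = _ := by rw [this]
  have e2 : ∀ i ∈ s, ((w i) ^ (1 / P) * u i) ^ P = w i * u i ^ (n + 1) := by
    intro i hi
    rw [Real.mul_rpow (Real.rpow_nonneg (hw i hi) _) (hu i hi), ← Real.rpow_mul (hw i hi),
      one_div_mul_cancel hP0.ne', Real.rpow_one, ← Real.rpow_natCast]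
    push_cast; rfl
  have e3 : ∀ i ∈ s, ((w i) ^ (1 / q) * v i ^ n) ^ q = w i * v i ^ (n + 1) := by
    intro i hi
    rw [Real.mul_rpow (Real.rpow_nonneg (hw i hi) _) (pow_nonneg (hv i hi) _),
      ← Real.rpow_mul (hw i hi), one_div_mul_cancel hq0.ne', Real.rpow_one, ← Real.rpow_natCast,
      ← Real.rpow_mul (hv i hi), ← Real.rpow_natCast]
    congr 2
    rw [hq]; push_cast; field_simp
  rw [Finset.sum_congr rfl e1, Finset.sum_congr rfl e2, Finset.sum_congr rfl e3] at h
  set S := ∑ i ∈ s, w i * u i * v i ^ n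
  set A := ∑ i ∈ s, w i * u i ^ (n + 1) with hA
  set B := ∑ i ∈ s, w i * v i ^ (n + 1) with hB
  have hS0 : 0 ≤ S := Finset.sum_nonneg fun i hi =>
    mul_nonneg (mul_nonneg (hw i hi) (hu i hi)) (pow_nonneg (hv i hi) _)
  have hA0 : 0 ≤ A := Finset.sum_nonneg fun i hi => mul_nonneg (hw i hi) (pow_nonneg (hu i hi) _)
  have hB0 : 0 ≤ B := Finset.sum_nonneg fun i hi => mul_nonneg (hw i hi) (pow_nonneg (hv i hi) _)
  calc S ^ (n + 1) ≤ (A ^ (1 / P) * B ^ (1 / q)) ^ (n + 1) := pow_le_pow_left₀ hS0 h _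
    _ = A * B ^ n := by
      rw [mul_pow, ← Real.rpow_natCast, ← Real.rpow_mul hA0, ← Real.rpow_natCast (B ^ (1 / q)),
        ← Real.rpow_mul hB0]
      have a1 : 1 / P * ((n + 1 : ℕ) : ℝ) = 1 := by rw [hP]; push_cast; field_simp
      have a2 : 1 / q * ((n + 1 : ℕ) : ℝ) = n := by rw [hq]; push_cast; field_simp
      rw [a1, a2, Real.rpow_one, Real.rpow_natCast]

section
variable {k M : ℕ} [NeZero M]

lemma fw_holder (w u v : (Fin k → ZMod M) → ℝ) (n : ℕ) (hw : ∀ i, 0 ≤ w i)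
    (hu : ∀ i, 0 ≤ u i) (hv : ∀ i, 0 ≤ v i) :
    (fwX fun α => w α * u α * v α ^ n) ^ (n + 1) ≤
      (fwX fun α => w α * u α ^ (n + 1)) * (fwX fun α => w α * v α ^ (n + 1)) ^ n := by
  unfold fwX
  have h := fw_holder0 Finset.univ w u v n (fun i _ => hw i) (fun i _ => hu i) (fun i _ => hv i)
  have hN : (0 : ℝ) < (M : ℝ) ^ k := pow_pos (by exact_mod_cast Nat.pos_of_ne_zero (NeZero.ne M)) _
  rw [div_pow, div_pow, div_mul_div_comm, ← pow_succ']
  gcongr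
end

lemma fw_S1 (r q : ℕ) (hr : 1 ≤ r) (hq : 1 ≤ q) : ∃ C : ℝ, 0 < C ∧
    ∀ (k M : ℕ) [NeZero M] (X p b : ℕ), 1 ≤ p → ∀ (η : ℤ) (g : (Fin k → ZMod M) → ℝ),
      (∀ α, 0 ≤ g α) → ∀ B : ℝ,
      (∀ ζ, (p : ℤ) ^ b ∣ ζ - η →
        fwX (fun α => g α * ‖fwf (fwc X p (b+1) ζ) α‖ ^ (2 * (r * q))) ≤ B) →
      fwX (fun α => g α * ‖fwf (fwc X p b η) α‖ ^ (2 * (r * q))) ≤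
        C * (fwX (fun α => g α * ‖fwS (fwT r X p b η) α‖ ^ (2 * q)) + (p : ℝ) ^ (r * q) * B) := by
  obtain ⟨C, hC, h⟩ := fw_point r q hr hq
  refine ⟨C, hC, ?_⟩
  intro k M _ X p b hp η g hg B hB
  have hB0 : 0 ≤ B := le_trans
    (fwX_nonneg fun α => mul_nonneg (hg α) (by positivity)) (hB η (by simp))
  have hcard : ((fwCl p b (b+1) η).card : ℝ) ≤ p := by
    have := fw_card_Cl hp (Nat.le_succ b) η
    simp at this
    exact_mod_cast this
  have hrq : 1 ≤ r * q := Nat.mul_pos hr hq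
  calc fwX (fun α => g α * ‖fwf (fwc X p b η) α‖ ^ (2 * (r * q)))
      ≤ fwX (fun α => C * (g α * ‖fwS (fwT r X p b η) α‖ ^ (2 * q) + (p : ℝ) ^ (r * q - 1) *
          ∑ ζ ∈ fwCl p b (b+1) η, g α * ‖fwf (fwc X p (b+1) ζ) α‖ ^ (2 * (r * q)))) := by
        refine fwX_mono fun α => ?_
        have h1 := h (fwCl p b (b+1) η) (fun ζ => fwf (fwc X p (b+1) ζ) α)
        rw [← fwf_split hp (Nat.le_succ b), ← fwS_T hp] at h1
        calc g α * ‖fwf (fwc X p b η) α‖ ^ (2 * (r * q)) ≤ g α * _ :=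
              mul_le_mul_of_nonneg_left h1 (hg α)
          _ ≤ g α * (C * (‖fwS (fwT r X p b η) α‖ ^ (2 * q) + (p : ℝ) ^ (r * q - 1) *
              ∑ ζ ∈ fwCl p b (b+1) η, ‖fwf (fwc X p (b+1) ζ) α‖ ^ (2 * (r * q)))) := by
              have := hg α
              gcongr
          _ = _ := by rw [← Finset.mul_sum]; ring
    _ = C * (fwX (fun α => g α * ‖fwS (fwT r X p b η) α‖ ^ (2 * q)) + (p : ℝ) ^ (r * q - 1) *
          ∑ ζ ∈ fwCl p b (b+1) η, fwX (fun α => g α * ‖fwf (fwc X p (b+1) ζ) α‖ ^ (2 * (r * q)))) := by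
        rw [fwX_mul, fwX_add, fwX_mul, fwX_sum]
    _ ≤ C * (fwX (fun α => g α * ‖fwS (fwT r X p b η) α‖ ^ (2 * q)) + (p : ℝ) ^ (r * q - 1) *
          (p * B)) := by
        gcongr
        calc _ ≤ ∑ _ζ ∈ fwCl p b (b+1) η, B :=
              Finset.sum_le_sum fun ζ hζ => hB ζ (fw_mem_fwCl.mp hζ).2
          _ = (fwCl p b (b+1) η).card * B := by simp
          _ ≤ _ := by gcongr
    _ = _ := by
        obtain ⟨m, hm⟩ : ∃ m, r * q = m + 1 := ⟨r * q - 1, by omega⟩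
        rw [hm, Nat.add_sub_cancel]; ring

noncomputable def fwI {M : ℕ} [NeZero M] (r t X p a b : ℕ) (ξ η : ℤ) : ℝ :=
  fwX (fun α : Fin (r + t) → ZMod M =>
    ‖fwS (fwT r X p a ξ) α‖ ^ 2 * ‖fwf (fwc X p b η) α‖ ^ (2 * (r * t)))

lemma fw_rec (r t : ℕ) (hr1 : 1 ≤ r) (hr : r ≤ t + 1) (ht : 1 ≤ t) : ∃ C : ℝ, 0 < C ∧
    ∀ (M : ℕ) [NeZero M] (X p a b b' : ℕ), p.Prime → r + t < p → 1 ≤ a → a < b →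
      b' + t * a = (t + 1) * b → (t + 1) * r * X ^ (r + t) < M →
      ∀ ξ η : ℤ, ¬ (p : ℤ) ∣ ξ - η → ∀ BI BJ BN D : ℝ, 0 ≤ D →
      (∀ ξ', (p : ℤ) ^ a ∣ ξ' - ξ → fwI (M := M) r t X p b b' η ξ' ≤ BI) →
      fwX (fun α : Fin (r + t) → ZMod M => ‖fwS (fwT r X p b η) α‖ ^ (2 * (t + 1))) ≤ BJ →
      (∀ ζ, (p : ℤ) ^ b ∣ ζ - η → fwI (M := M) r t X p a (b + 1) ξ ζ ≤ BN) →
      ((p : ℝ) ^ (r * (b' - a))) ^ t * (BI * BJ ^ (t - 1)) ≤ D ^ t →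
      fwI (M := M) r t X p a b ξ η ≤ C * (D + (p : ℝ) ^ (r * t) * BN) := by
  obtain ⟨C, hC, h1⟩ := fw_S1 r t hr1 ht
  refine ⟨C * (r ^ (r + 1) + 1), by positivity, ?_⟩
  intro M _ X p a b b' hp hpk ha hab hb' hM ξ η hξη BI BJ BN D hD hBI hBJ hBN hDt
  have hp0 : (0 : ℝ) < p := by exact_mod_cast hp.pos
  have hBN0 : 0 ≤ BN := le_trans (fwX_nonneg fun α => by positivity) (hBN η (by simp))
  have hBI0 : 0 ≤ BI := le_trans (fwX_nonneg fun α => by positivity) (hBI ξ (by simp))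
  have h2 := h1 (r + t) M X p b hp.one_lt.le η (fun α => ‖fwS (fwT r X p a ξ) α‖ ^ 2)
    (fun α => by positivity) BN hBN
  set PP : ℝ := (p : ℝ) ^ (r * (b' - a)) with hPP
  have hPP0 : 0 < PP := by positivity
  have h3 := fw_S2 (M := M) hp hpk hr1 hr ha hab hb' hM ξ η hξη (D / PP) (by
    intro ξ' hξ'
    obtain ⟨n, rfl⟩ : ∃ n, t = n + 1 := ⟨t - 1, by omega⟩
    set G := fwX (fun α : Fin (r + (n + 1)) → ZMod M =>
      ‖fwf (fwc X p b' ξ') α‖ ^ (2 * r) * ‖fwS (fwT r X p b η) α‖ ^ (2 * (n + 1))) with hG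
    have hG0 : 0 ≤ G := fwX_nonneg fun α => by positivity
    have hh := fw_holder (k := r + (n + 1)) (M := M) (fun α => ‖fwS (fwT r X p b η) α‖ ^ 2)
      (fun α => ‖fwf (fwc X p b' ξ') α‖ ^ (2 * r)) (fun α => ‖fwS (fwT r X p b η) α‖ ^ 2) n
      (fun α => by positivity) (fun α => by positivity) (fun α => by positivity)
    have e1 : (fwX fun α : Fin (r + (n + 1)) → ZMod M => ‖fwS (fwT r X p b η) α‖ ^ 2 *
        ‖fwf (fwc X p b' ξ') α‖ ^ (2 * r) * (‖fwS (fwT r X p b η) α‖ ^ 2) ^ n) = G := by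
      rw [hG]; congr 1; funext α; ring
    have e2 : (fwX fun α : Fin (r + (n + 1)) → ZMod M => ‖fwS (fwT r X p b η) α‖ ^ 2 *
        (‖fwf (fwc X p b' ξ') α‖ ^ (2 * r)) ^ (n + 1)) ≤ BI := by
      refine le_trans (le_of_eq ?_) (hBI ξ' hξ')
      unfold fwI; congr 1; funext α; rw [← pow_mul, mul_assoc]
    have e3 : (fwX fun α : Fin (r + (n + 1)) → ZMod M => ‖fwS (fwT r X p b η) α‖ ^ 2 *
        (‖fwS (fwT r X p b η) α‖ ^ 2) ^ (n + 1)) ≤ BJ := by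
      refine le_trans (le_of_eq ?_) hBJ
      congr 1; funext α; ring
    rw [e1] at hh
    rw [le_div_iff₀ hPP0]
    refine le_of_pow_le_pow_left₀ (n := n + 1) (by omega) hD ?_
    calc (G * PP) ^ (n + 1) = PP ^ (n + 1) * G ^ (n + 1) := by ring
      _ ≤ PP ^ (n + 1) * (BI * BJ ^ n) := by
          gcongr
          refine hh.trans ?_
          have e4 : 0 ≤ (fwX fun α : Fin (r + (n + 1)) → ZMod M => ‖fwS (fwT r X p b η) α‖ ^ 2 *
            (‖fwS (fwT r X p b η) α‖ ^ 2) ^ (n + 1)) := fwX_nonneg fun α => by positivity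
          exact mul_le_mul e2 (pow_le_pow_left₀ e4 e3 n) (pow_nonneg e4 n) hBI0
      _ ≤ D ^ (n + 1) := hDt)
  have h4 : (r : ℝ) ^ (r + 1) * PP * (D / PP) = (r : ℝ) ^ (r + 1) * D := by field_simp
  rw [h4] at h3
  calc fwI (M := M) r t X p a b ξ η ≤ _ := h2
    _ ≤ C * ((r : ℝ) ^ (r + 1) * D + (p : ℝ) ^ (r * t) * BN) := by gcongr
    _ ≤ C * (((r : ℝ) ^ (r + 1) + 1) * (D + (p : ℝ) ^ (r * t) * BN)) := by
        gcongr
        have : 0 ≤ (p : ℝ) ^ (r * t) * BN := by positivity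
        have : 0 ≤ (r : ℝ) ^ (r + 1) * ((p : ℝ) ^ (r * t) * BN) := by positivity
        nlinarith
    _ = _ := by ring


def fwHyp (r t : ℕ) (Δ A : ℝ) : Prop := ∀ N : ℕ, 1 ≤ N →
  (J ((t + 1) * r) (r + t) (N : ℝ) : ℝ) ≤ A * (N : ℝ) ^ ((((t + 1) * r : ℕ) : ℝ) + Δ)

lemma fwHyp_nonneg {r t : ℕ} {Δ A : ℝ} (h : fwHyp r t Δ A) : 0 ≤ A := by
  have := h 1 le_rfl
  simp at this
  exact le_trans (Nat.cast_nonneg _) this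

lemma fw_w_mem {p : ℕ} (hp : 1 ≤ p) {Δ : ℝ} (hΔ : 0 ≤ Δ) :
    0 < (p : ℝ) ^ (-Δ) ∧ (p : ℝ) ^ (-Δ) ≤ 1 := by
  have : (1 : ℝ) ≤ p := by exact_mod_cast hp
  exact ⟨by positivity, Real.rpow_le_one_of_one_le_of_nonpos this (by linarith)⟩

lemma fw_C2 {r t : ℕ} {Δ A : ℝ} (hΔ : 0 ≤ Δ) (hyp : fwHyp r t Δ A) {M : ℕ} [NeZero M]
    {X p b : ℕ} (hp : 1 ≤ p) (hX : p ^ b ≤ X) (hM : (t + 1) * r * X ^ (r + t) < M) (η : ℤ)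
    (T : Finset (Fin r → ℤ)) (hT : ∀ x ∈ T, ∀ i, x i ∈ fwc X p b η) :
    fwX (fun α : Fin (r + t) → ZMod M => ‖fwS T α‖ ^ (2 * (t + 1)))
      ≤ ((A + 1) * 2 ^ ((((t + 1) * r : ℕ) : ℝ) + Δ)) * ((X : ℝ) / (p : ℝ) ^ b) ^ (r * (t + 1))
        * (X : ℝ) ^ Δ * ((p : ℝ) ^ (-Δ)) ^ b := by
  have hA := fwHyp_nonneg hyp
  have hp0 : (0 : ℝ) < p := by exact_mod_cast hp
  have hpb : (0 : ℝ) < (p : ℝ) ^ b := by positivity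
  have hX0 : (0 : ℝ) < X := by
    have : 0 < p ^ b := by positivity
    exact_mod_cast lt_of_lt_of_le this hX
  have h1 : (1 : ℝ) ≤ (X : ℝ) / (p : ℝ) ^ b := by
    rw [le_div_iff₀ hpb]; rw [one_mul]; exact_mod_cast hX
  refine (fw_C1 hp hM η T hT).trans ((hyp _ (Nat.le_add_left 1 _)).trans ?_)
  have h2 : ((X / p ^ b + 1 : ℕ) : ℝ) ≤ 2 * ((X : ℝ) / (p : ℝ) ^ b) := by
    have : ((X / p ^ b : ℕ) : ℝ) ≤ (X : ℝ) / ((p ^ b : ℕ) : ℝ) := Nat.cast_div_le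
    push_cast at this ⊢
    linarith
  calc A * ((X / p ^ b + 1 : ℕ) : ℝ) ^ ((((t + 1) * r : ℕ) : ℝ) + Δ)
      ≤ (A + 1) * (2 * ((X : ℝ) / (p : ℝ) ^ b)) ^ ((((t + 1) * r : ℕ) : ℝ) + Δ) := by
        gcongr; linarith
    _ = (A + 1) * (2 ^ ((((t + 1) * r : ℕ) : ℝ) + Δ) *
          (((X : ℝ) / (p : ℝ) ^ b) ^ (r * (t + 1)) * ((X : ℝ) ^ Δ * ((p : ℝ) ^ (-Δ)) ^ b))) := by
        rw [Real.mul_rpow (by norm_num) (by positivity), Real.rpow_add (x := (X : ℝ) / (p : ℝ) ^ b)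
          (by positivity), Real.rpow_natCast, mul_comm (t + 1) r]
        congr 3
        rw [Real.div_rpow hX0.le hpb.le, div_eq_mul_inv]
        congr 1
        rw [Real.rpow_neg hp0.le, inv_pow, ← Real.rpow_natCast, ← Real.rpow_mul hp0.le,
          ← Real.rpow_natCast, ← Real.rpow_mul hp0.le, mul_comm]
    _ = _ := by ring

lemma fw_triv {r t : ℕ} {Δ A : ℝ} (hΔ : 0 ≤ Δ) (hyp : fwHyp r t Δ A) {M : ℕ} [NeZero M]
    {X p a b E : ℕ} (hp : 1 ≤ p) (hXa : p ^ a ≤ X) (hXb : p ^ b ≤ X)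
    (hM : (t + 1) * r * X ^ (r + t) < M) (ξ η : ℤ)
    (Q R : Finset (Fin r → ℤ)) (hQ : ∀ x ∈ Q, ∀ i, x i ∈ fwc X p a ξ)
    (hR : ∀ x ∈ R, ∀ i, x i ∈ fwc X p b η) (hE : (t + 1) * E ≤ a + t * b) :
    fwX (fun α : Fin (r + t) → ZMod M => ‖fwS Q α‖ ^ 2 * ‖fwS R α‖ ^ (2 * t))
      ≤ ((A + 1) * 2 ^ ((((t + 1) * r : ℕ) : ℝ) + Δ)) * ((X : ℝ) / (p : ℝ) ^ a) ^ r
        * ((X : ℝ) / (p : ℝ) ^ b) ^ (r * t) * (X : ℝ) ^ Δ * ((p : ℝ) ^ (-Δ)) ^ E := by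
  have hA := fwHyp_nonneg hyp
  have hp0 : (0 : ℝ) < p := by exact_mod_cast hp
  have h1 := fw_C2 hΔ hyp hp hXa hM ξ Q hQ
  have h2 := fw_C2 hΔ hyp hp hXb hM η R hR
  obtain ⟨hw0, hw1⟩ := fw_w_mem hp hΔ
  set w := (p : ℝ) ^ (-Δ) with hw
  set y := (X : ℝ) ^ Δ with hy
  have hy0 : 0 ≤ y := by positivity
  set A' := (A + 1) * 2 ^ ((((t + 1) * r : ℕ) : ℝ) + Δ) with hA'
  have hA0 : 0 ≤ A' := by positivity
  set Xa := (X : ℝ) / (p : ℝ) ^ a with hXa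
  set Xb := (X : ℝ) / (p : ℝ) ^ b with hXb
  have hXa0 : 0 ≤ Xa := by positivity
  have hXb0 : 0 ≤ Xb := by positivity
  have hh := fw_holder (k := r + t) (M := M) (fun _ => 1) (fun α => ‖fwS Q α‖ ^ 2)
    (fun α => ‖fwS R α‖ ^ 2) t (fun α => by positivity) (fun α => by positivity)
    (fun α => by positivity)
  simp only [one_mul, ← pow_mul] at hh
  refine le_of_pow_le_pow_left₀ (n := t + 1) (by omega) (by positivity) ?_
  calc _ ≤ _ := hh
    _ ≤ (A' * Xa ^ (r * (t + 1)) * y * w ^ a) * (A' * Xb ^ (r * (t + 1)) * y * w ^ b) ^ t := by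
        have e4 : 0 ≤ (fwX fun α : Fin (r + t) → ZMod M => ‖fwS R α‖ ^ (2 * (t + 1))) :=
          fwX_nonneg fun α => by positivity
        exact mul_le_mul h1 (pow_le_pow_left₀ e4 h2 t) (pow_nonneg e4 t) (by positivity)
    _ = (A' * Xa ^ r * Xb ^ (r * t) * y) ^ (t + 1) * w ^ (a + t * b) := by ring
    _ ≤ (A' * Xa ^ r * Xb ^ (r * t) * y) ^ (t + 1) * w ^ ((t + 1) * E) := by
        gcongr ?_ * ?_
        exact pow_le_pow_of_le_one hw0.le hw1 hE
    _ = _ := by ring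

def fwH (r t E a b : ℕ) : Prop := ∃ L : ℕ, ∀ Δ A : ℝ, 0 ≤ Δ → fwHyp r t Δ A → ∃ C : ℝ, 0 < C ∧
  ∀ (M : ℕ) [NeZero M] (X p : ℕ), p.Prime → r + t < p → p ^ L ≤ X →
    (t + 1) * r * X ^ (r + t) < M → ∀ ξ η : ℤ, ¬ (p : ℤ) ∣ ξ - η →
    fwI (M := M) r t X p a b ξ η ≤ C * ((X : ℝ) / (p : ℝ) ^ a) ^ r
        * ((X : ℝ) / (p : ℝ) ^ b) ^ (r * t) * (X : ℝ) ^ Δ * ((p : ℝ) ^ (-Δ)) ^ E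

lemma fw_pow_le {p X a L : ℕ} (hp : 1 ≤ p) (h : p ^ L ≤ X) (ha : a ≤ L) : p ^ a ≤ X :=
  (Nat.pow_le_pow_right hp ha).trans h

lemma fwf_pow {k M : ℕ} [NeZero M] (r t : ℕ) (A : Finset ℤ) (α : Fin k → ZMod M) :
    ‖fwf A α‖ ^ (2 * (r * t)) = ‖fwS (Fintype.piFinset fun _ : Fin r => A) α‖ ^ (2 * t) := by
  rw [fwS_pi]
  simp only [Finset.prod_const, Finset.card_univ, Fintype.card_fin, norm_pow]
  rw [← pow_mul]; ring_nf

lemma fwH_triv {r t E a b : ℕ} (hE : (t + 1) * E ≤ a + t * b) : fwH r t E a b := by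
  refine ⟨a + b, fun Δ A hΔ hyp => ⟨(A + 1) * 2 ^ ((((t + 1) * r : ℕ) : ℝ) + Δ), ?_, ?_⟩⟩
  · have := fwHyp_nonneg hyp; positivity
  intro M _ X p hp hpk hX hM ξ η hξη
  have hp1 := hp.one_lt.le
  unfold fwI
  simp_rw [fwf_pow]
  exact fw_triv hΔ hyp hp1 (fw_pow_le hp1 hX (by omega)) (fw_pow_le hp1 hX (by omega)) hM ξ η _ _
    (fun x hx => (fw_mem_fwT.mp hx).1) (fun x hx i => by simpa using (Fintype.mem_piFinset.mp hx) i)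
    hE

lemma fw_not_dvd {p : ℕ} {n : ℕ} (hn : 1 ≤ n) {ξ η ξ' : ℤ} (h : ¬ (p : ℤ) ∣ ξ - η)
    (h' : (p : ℤ) ^ n ∣ ξ' - ξ) : ¬ (p : ℤ) ∣ ξ' - η := by
  intro h2
  apply h
  have h3 : (p : ℤ) ∣ ξ' - ξ := (dvd_pow_self _ (by omega)).trans h'
  have := dvd_sub h2 h3
  simpa using this

lemma fwH_step {r t : ℕ} (hr1 : 1 ≤ r) (hr : r ≤ t + 1) (ht : 1 ≤ t) {E E1 a d : ℕ} (ha : 1 ≤ a)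
    (hd : 1 ≤ d) (h1 : fwH r t E1 (a + d) (a + d + t * d))
    (hE : t * E ≤ E1 + (t - 1) * (a + d)) (h2 : fwH r t E a (a + d + 1)) :
    fwH r t E a (a + d) := by
  obtain ⟨L1, h1⟩ := h1
  obtain ⟨L2, h2⟩ := h2
  obtain ⟨C0, hC0, hrec⟩ := fw_rec r t hr1 hr ht
  refine ⟨L1 + L2 + a + d, fun Δ A hΔ hyp => ?_⟩
  obtain ⟨C1, hC1, h1⟩ := h1 Δ A hΔ hyp
  obtain ⟨C2, hC2, h2⟩ := h2 Δ A hΔ hyp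
  have hA := fwHyp_nonneg hyp
  set A' := (A + 1) * 2 ^ ((((t + 1) * r : ℕ) : ℝ) + Δ) with hA'
  have hA0 : 0 < A' := by positivity
  set C3 := C1 + A' with hC3
  have hC30 : 0 < C3 := by positivity
  refine ⟨C0 * (C3 + C2), by positivity, ?_⟩
  intro M _ X p hp hpk hX hM ξ η hξη
  have hp1 := hp.one_lt.le
  have hp0 : (0 : ℝ) < p := by exact_mod_cast hp1
  have g1 := h1 M X p hp hpk (fw_pow_le hp1 hX (by omega)) hM
  have g2 := h2 M X p hp hpk (fw_pow_le hp1 hX (by omega)) hM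
  have g3 := fw_C2 hΔ hyp hp1 (fw_pow_le (a := a + d) hp1 hX (by omega)) hM η (fwT r X p (a + d) η)
    (fun x hx => (fw_mem_fwT.mp hx).1)
  obtain ⟨hw0, hw1⟩ := fw_w_mem hp1 hΔ
  set w := (p : ℝ) ^ (-Δ) with hw
  set y := (X : ℝ) ^ Δ with hy
  have hy0 : 0 ≤ y := by positivity
  rw [← hA'] at g3
  have hξη' : ¬ (p : ℤ) ∣ η - ξ := by rwa [dvd_sub_comm]
  set P : ℝ := (p : ℝ) with hP
  set U : ℝ := (X : ℝ) / P ^ (a + d) with hU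
  have hU0 : 0 ≤ U := by positivity
  have eXa : (X : ℝ) / P ^ a = U * P ^ d := by rw [hU, pow_add]; field_simp
  have key := hrec M X p a (a + d) (a + d + t * d) hp hpk ha (by omega) (by ring) hM ξ η hξη
    (C3 * U ^ r * ((X : ℝ) / P ^ (a + d + t * d)) ^ (r * t) * y * w ^ E1)
    (C3 * U ^ (r * (t + 1)) * y * w ^ (a + d))
    (C2 * ((X : ℝ) / P ^ a) ^ r * ((X : ℝ) / P ^ (a + d + 1)) ^ (r * t) * y * w ^ E)
    (C3 * ((X : ℝ) / P ^ a) ^ r * U ^ (r * t) * y * w ^ E)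
    (by positivity)
    (fun ξ' hξ' => (g1 η ξ' (by
      rw [dvd_sub_comm]; exact fw_not_dvd ha hξη hξ')).trans (by
        gcongr; rw [hC3]; linarith))
    (g3.trans (by gcongr; rw [hC3]; linarith))
    (fun ζ hζ => g2 ξ ζ (by
      rw [dvd_sub_comm]; exact fw_not_dvd (by omega) hξη' hζ))
    (by
      obtain ⟨n, rfl⟩ : ∃ n, t = n + 1 := ⟨t - 1, by omega⟩
      have eb : a + d + (n + 1) * d - a = (n + 2) * d := by
        have : a + d + (n + 1) * d = a + (n + 2) * d := by ring
        omega
      rw [eb, ← hP]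
      simp only [Nat.add_sub_cancel] at hE ⊢
      rw [eXa]
      set V : ℝ := (X : ℝ) / P ^ (a + d + (n + 1) * d) with hV
      have eV : P ^ ((n + 2) * d) * V = U * P ^ d := by
        rw [hV, hU]
        rw [pow_add P (a + d), show (n + 2) * d = (n + 1) * d + d by ring,
          pow_add P ((n + 1) * d) d]
        field_simp
      calc _ = C3 ^ (n + 1) * (P ^ ((n + 2) * d) * V) ^ (r * (n + 1)) * U ^ (r * (n + 1) * (n + 1))
            * y ^ (n + 1) * w ^ (E1 + n * (a + d)) := by ring
        _ ≤ C3 ^ (n + 1) * (U * P ^ d) ^ (r * (n + 1)) * U ^ (r * (n + 1) * (n + 1))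
            * y ^ (n + 1) * w ^ ((n + 1) * E) := by
            rw [eV]
            gcongr ?_ * ?_
            exact pow_le_pow_of_le_one hw0.le hw1 hE
        _ = _ := by ring)
  rw [← hP] at key
  refine key.trans (le_of_eq ?_)
  have e5 : P ^ (r * t) * ((X : ℝ) / P ^ (a + d + 1)) ^ (r * t) = U ^ (r * t) := by
    rw [← mul_pow, hU, pow_succ]
    congr 1
    field_simp
  calc _ = C0 * (C3 * ((X : ℝ) / P ^ a) ^ r * U ^ (r * t) * y * w ^ E + C2 * ((X : ℝ) / P ^ a) ^ r *
        (P ^ (r * t) * ((X : ℝ) / P ^ (a + d + 1)) ^ (r * t)) * y * w ^ E) := by ring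
    _ = _ := by rw [e5]; ring

lemma fwH_all {r t : ℕ} (hr1 : 1 ≤ r) (hr : r ≤ t + 1) (ht : 1 ≤ t) (n : ℕ) :
    ∀ a d, 1 ≤ a → 1 ≤ d → fwH r t (a + n * d) a (a + d) := by
  induction n with
  | zero =>
    intro a d ha hd
    exact fwH_triv (by nlinarith)
  | succ n ih =>
    intro a d0 ha hd0
    set E := a + (n + 1) * d0 with hE
    have key : ∀ m d, d0 ≤ d → (t + 1) * E ≤ d + m → fwH r t E a (a + d) := by
      intro m
      induction m with
      | zero =>
        intro d hd hm
        exact fwH_triv (by nlinarith)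
      | succ m ihm =>
        intro d hd hm
        refine fwH_step hr1 hr ht ha (by omega) (ih (a + d) (t * d) (by omega) (by nlinarith)) ?_
          (ihm (d + 1) (by omega) (by omega))
        obtain ⟨n', rfl⟩ : ∃ n', t = n' + 1 := ⟨t - 1, by omega⟩
        simp only [Nat.add_sub_cancel]
        have : (n' + 1) * E ≤ (n' + 1) * (a + (n + 1) * d) := by rw [hE]; gcongr
        refine this.trans (le_of_eq_of_le ?_ (Nat.le_refl _))
        ring
    exact key ((t + 1) * E) d0 le_rfl (by omega)


lemma fw_powmean {ι : Type*} (s : Finset ι) (x : ι → ℝ) (hx : ∀ i ∈ s, 0 ≤ x i) (N : ℕ)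
    (hN : 1 ≤ N) : (∑ i ∈ s, x i) ^ N ≤ (s.card : ℝ) ^ N * ∑ i ∈ s, x i ^ N := by
  rcases s.eq_empty_or_nonempty with rfl | hs
  · have : N ≠ 0 := by omega
    simp [this]
  obtain ⟨m, hm, hmax⟩ := Finset.exists_max_image s x hs
  have h1 : ∑ i ∈ s, x i ≤ s.card * x m := by
    calc _ ≤ ∑ _i ∈ s, x m := Finset.sum_le_sum hmax
      _ = _ := by simp
  calc _ ≤ (s.card * x m) ^ N := pow_le_pow_left₀ (Finset.sum_nonneg hx) h1 _
    _ = (s.card : ℝ) ^ N * x m ^ N := mul_pow _ _ _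
    _ ≤ _ := by
      gcongr
      exact Finset.single_le_sum (f := fun i => x i ^ N) (fun i hi => pow_nonneg (hx i hi) _) hm

lemma fw_prod2 {n r t : ℕ} (hr : 1 ≤ r) (ht : 1 ≤ t) (hn : n = (t + 1) * r) (x : Fin n → ℝ)
    (hx : ∀ i, 0 ≤ x i) : ∏ i, x i ^ 2 ≤
      ∑ q ∈ (Finset.univ : Finset (Fin n × Fin n)).filter (fun q => q.1 ≠ q.2),
        x q.2 ^ (2 * (r * t)) * x q.1 ^ (2 * (r * 1)) := by
  have hn2 : 2 ≤ n := by nlinarith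
  have : (Finset.univ : Finset (Fin n)).Nonempty := ⟨⟨0, by omega⟩, Finset.mem_univ _⟩
  obtain ⟨i, -, hi⟩ := Finset.exists_max_image Finset.univ x this
  have h2 : (Finset.univ.erase i).Nonempty := by
    rw [← Finset.card_pos, Finset.card_erase_of_mem (Finset.mem_univ i)]
    simp; omega
  obtain ⟨j, hj, hmax⟩ := Finset.exists_max_image (Finset.univ.erase i) x h2
  have hij : i ≠ j := (Finset.ne_of_mem_erase hj).symm
  have hji := hi j (Finset.mem_univ j)
  obtain ⟨r', rfl⟩ : ∃ r', r = r' + 1 := ⟨r - 1, by omega⟩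
  have hcard : (Finset.univ.erase i).card = (r' + 1) * t + r' := by
    rw [Finset.card_erase_of_mem (Finset.mem_univ i)]
    simp only [Finset.card_univ, Fintype.card_fin, hn]
    have : (t + 1) * (r' + 1) = (r' + 1) * t + r' + 1 := by ring
    omega
  calc ∏ i, x i ^ 2 = x i ^ 2 * ∏ l ∈ Finset.univ.erase i, x l ^ 2 :=
        (Finset.mul_prod_erase _ _ (Finset.mem_univ i)).symm
    _ ≤ x i ^ 2 * ∏ _l ∈ Finset.univ.erase i, x j ^ 2 := by
        gcongr with l hl
        · exact hx l
        · exact hmax l hl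
    _ = x i ^ 2 * (x j ^ (2 * ((r' + 1) * t)) * x j ^ (2 * r')) := by
        rw [Finset.prod_const, hcard, ← pow_mul, ← pow_add]; ring_nf
    _ ≤ x i ^ 2 * (x j ^ (2 * ((r' + 1) * t)) * x i ^ (2 * r')) := by
        have := hx i; have := hx j
        gcongr
    _ = x j ^ (2 * ((r' + 1) * t)) * x i ^ (2 * ((r' + 1) * 1)) := by ring
    _ ≤ _ := Finset.single_le_sum (f := fun q : Fin n × Fin n =>
        x q.2 ^ (2 * ((r' + 1) * t)) * x q.1 ^ (2 * ((r' + 1) * 1)))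
        (a := (i, j)) (fun q _ => mul_nonneg (pow_nonneg (hx _) _) (pow_nonneg (hx _) _))
        (by simp [hij])

def fwG (r t E c n a : ℕ) : Prop := ∃ L : ℕ, ∀ Δ A : ℝ, 0 ≤ Δ → fwHyp r t Δ A → ∃ C : ℝ, 0 < C ∧
  ∀ (M : ℕ) [NeZero M] (X p : ℕ), p.Prime → r + t < p → p ^ L ≤ X →
    (t + 1) * r * X ^ (r + t) < M → ∀ ξ η : ℤ, ¬ (p : ℤ) ∣ ξ - η →
    fwX (fun α : Fin (r + t) → ZMod M => ‖fwf (fwc X p 1 η) α‖ ^ (2 * (r * t)) *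
        ‖fwf (fwc X p a ξ) α‖ ^ (2 * (r * 1))) ≤ C * ((X : ℝ) / (p : ℝ) ^ a) ^ r
        * ((X : ℝ) / (p : ℝ) ^ 1) ^ (r * t) * (X : ℝ) ^ Δ *
        (((p : ℝ) ^ (-Δ)) ^ E + (p : ℝ) ^ c * ((p : ℝ) ^ (-Δ)) ^ n)

lemma fwG_all {r t : ℕ} (hr1 : 1 ≤ r) (hr : r ≤ t + 1) (ht : 1 ≤ t) (E n h : ℕ)
    (hE : (t + 1) * E ≤ h) (m : ℕ) : ∀ a, 1 ≤ a → a + m = h →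
    fwG r t E (h * (2 * (r * t) + 1)) n a := by
  induction m with
  | zero =>
    intro a ha hah
    refine ⟨a + 1, fun Δ A hΔ hyp => ⟨(A + 1) * 2 ^ ((((t + 1) * r : ℕ) : ℝ) + Δ), ?_, ?_⟩⟩
    · have := fwHyp_nonneg hyp; positivity
    intro M _ X p hp hpk hX hM ξ η hξη
    have hp1 := hp.one_lt.le
    have hA := fwHyp_nonneg hyp
    simp_rw [fwf_pow]
    have h1 := fw_triv (E := E) hΔ hyp hp1 (fw_pow_le (a := a) hp1 hX (by omega))
      (fw_pow_le (a := 1) hp1 hX (by omega)) hM ξ η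
      (Fintype.piFinset fun _ : Fin r => fwc X p a ξ)
      (Fintype.piFinset fun _ : Fin r => fwc X p 1 η)
      (fun x hx i => by simpa using (Fintype.mem_piFinset.mp hx) i)
      (fun x hx i => by simpa using (Fintype.mem_piFinset.mp hx) i) (by omega)
    refine le_trans (le_of_eq ?_) (h1.trans ?_)
    · congr 1; funext α; rw [mul_comm, mul_one]
    · gcongr
      have : 0 ≤ (p : ℝ) ^ (h * (2 * (r * t) + 1)) * ((p : ℝ) ^ (-Δ)) ^ n := by positivity
      linarith
  | succ m ih =>
    intro a ha hah
    obtain ⟨L1, h1⟩ := ih (a + 1) (by omega) (by omega)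
    obtain ⟨L2, h2⟩ := fwH_all hr1 hr ht n a 1 ha le_rfl
    obtain ⟨C0, hC0, hS⟩ := fw_S1 r 1 hr1 le_rfl
    refine ⟨L1 + L2, fun Δ A hΔ hyp => ?_⟩
    obtain ⟨C1, hC1, h1⟩ := h1 Δ A hΔ hyp
    obtain ⟨C2, hC2, h2⟩ := h2 Δ A hΔ hyp
    refine ⟨C0 * (C2 + C1), by positivity, ?_⟩
    intro M _ X p hp hpk hX hM ξ η hξη
    have hp1 := hp.one_lt.le
    have hp0 : (1 : ℝ) ≤ p := by exact_mod_cast hp1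
    have hξη' : ¬ (p : ℤ) ∣ η - ξ := by rwa [dvd_sub_comm]
    have g1 := h1 M X p hp hpk (fw_pow_le hp1 hX (by omega)) hM
    have g2 := h2 M X p hp hpk (fw_pow_le hp1 hX (by omega)) hM
    set c := h * (2 * (r * t) + 1) with hc
    obtain ⟨hw0, hw1⟩ := fw_w_mem hp1 hΔ
    have key := hS (r + t) M X p a hp1 ξ (fun α => ‖fwf (fwc X p 1 η) α‖ ^ (2 * (r * t)))
      (fun α => by positivity) _ (fun ζ hζ => g1 ζ η (fw_not_dvd ha hξη hζ))
    set w := (p : ℝ) ^ (-Δ) with hw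
    set y := (X : ℝ) ^ Δ with hy
    have hy0 : 0 ≤ y := by positivity
    set P : ℝ := (p : ℝ) with hP
    set X1 : ℝ := (X : ℝ) / P ^ 1 with hX1
    set Xa : ℝ := (X : ℝ) / P ^ a with hXa
    have hXa0 : 0 ≤ Xa := by positivity
    have hX10 : 0 ≤ X1 := by positivity
    have hrt : 1 ≤ 2 * (r * t) := by nlinarith
    have hbroad : fwX (fun α : Fin (r + t) → ZMod M => ‖fwf (fwc X p 1 η) α‖ ^ (2 * (r * t)) *
        ‖fwS (fwT r X p a ξ) α‖ ^ (2 * 1)) ≤ P ^ c * (C2 * Xa ^ r * X1 ^ (r * t) * y * w ^ n) := by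
      have hcard : ((fwCl p 1 (a + 1) η).card : ℝ) ≤ P ^ a := by
        have := fw_card_Cl hp1 (show 1 ≤ a + 1 by omega) η
        simp only [Nat.add_sub_cancel] at this
        rw [hP]; exact_mod_cast this
      calc _ ≤ fwX (fun α : Fin (r + t) → ZMod M => (P ^ a) ^ (2 * (r * t)) *
            ∑ ζ ∈ fwCl p 1 (a + 1) η, ‖fwS (fwT r X p a ξ) α‖ ^ 2 *
              ‖fwf (fwc X p (a + 1) ζ) α‖ ^ (2 * (r * t))) := by
            refine fwX_mono fun α => ?_
            rw [fwf_split hp1 (show 1 ≤ a + 1 by omega) η α, ← Finset.mul_sum]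
            calc _ ≤ ((P ^ a) ^ (2 * (r * t)) * ∑ ζ ∈ fwCl p 1 (a + 1) η,
                  ‖fwf (fwc X p (a + 1) ζ) α‖ ^ (2 * (r * t))) *
                  ‖fwS (fwT r X p a ξ) α‖ ^ (2 * 1) := by
                  gcongr
                  calc _ ≤ (∑ ζ ∈ fwCl p 1 (a + 1) η, ‖fwf (fwc X p (a + 1) ζ) α‖) ^ (2 * (r * t)) :=
                        pow_le_pow_left₀ (norm_nonneg _) (norm_sum_le _ _) _
                    _ ≤ _ := fw_powmean _ _ (fun _ _ => norm_nonneg _) _ hrt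
                    _ ≤ _ := by gcongr
              _ = _ := by ring
        _ = (P ^ a) ^ (2 * (r * t)) * ∑ ζ ∈ fwCl p 1 (a + 1) η,
              fwI (M := M) r t X p a (a + 1) ξ ζ := by
            rw [fwX_mul, fwX_sum]; rfl
        _ ≤ (P ^ a) ^ (2 * (r * t)) * ∑ _ζ ∈ fwCl p 1 (a + 1) η,
              (C2 * Xa ^ r * X1 ^ (r * t) * y * w ^ n) := by
            gcongr with ζ hζ
            refine (g2 ξ ζ ?_).trans ?_
            · rw [dvd_sub_comm]
              exact fw_not_dvd le_rfl hξη' (fw_mem_fwCl.mp hζ).2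
            · gcongr ?_ * ?_ ^ _ * _ * ?_
              · rw [hX1]
                gcongr
                omega
              · exact pow_le_pow_of_le_one hw0.le hw1 (by omega)
        _ ≤ (P ^ a) ^ (2 * (r * t)) * (P ^ a * (C2 * Xa ^ r * X1 ^ (r * t) * y * w ^ n)) := by
            rw [Finset.sum_const, nsmul_eq_mul]
            gcongr
        _ = P ^ (a * (2 * (r * t) + 1)) * (C2 * Xa ^ r * X1 ^ (r * t) * y * w ^ n) := by ring
        _ ≤ _ := by
            gcongr
            rw [hc]; gcongr; omega
    refine key.trans ?_
    have e5 : P ^ (r * 1) * ((X : ℝ) / P ^ (a + 1)) ^ r = Xa ^ r := by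
      rw [mul_one, ← mul_pow, hXa, pow_succ]
      congr 1
      field_simp
    calc _ ≤ C0 * (P ^ c * (C2 * Xa ^ r * X1 ^ (r * t) * y * w ^ n) + P ^ (r * 1) *
          (C1 * ((X : ℝ) / P ^ (a + 1)) ^ r * X1 ^ (r * t) * y * (w ^ E + P ^ c * w ^ n))) := by
          gcongr
      _ = C0 * (P ^ c * (C2 * Xa ^ r * X1 ^ (r * t) * y * w ^ n) +
          (C1 * (P ^ (r * 1) * ((X : ℝ) / P ^ (a + 1)) ^ r) * X1 ^ (r * t) * y *
            (w ^ E + P ^ c * w ^ n))) := by ring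
      _ = C0 * (C2 * Xa ^ r * X1 ^ (r * t) * y * (P ^ c * w ^ n) +
          (C1 * Xa ^ r * X1 ^ (r * t) * y * (w ^ E + P ^ c * w ^ n))) := by rw [e5]; ring
      _ ≤ C0 * (C2 * Xa ^ r * X1 ^ (r * t) * y * (w ^ E + P ^ c * w ^ n) +
          (C1 * Xa ^ r * X1 ^ (r * t) * y * (w ^ E + P ^ c * w ^ n))) := by
          gcongr
          have : 0 ≤ w ^ E := by positivity
          linarith
      _ = _ := by ring


lemma fw_main {r t : ℕ} (hr1 : 1 ≤ r) (hr : r ≤ t + 1) (ht : 1 ≤ t) (E : ℕ) :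
    ∃ c : ℕ, ∀ n : ℕ, ∃ L : ℕ, ∀ Δ A : ℝ, 0 ≤ Δ → fwHyp r t Δ A → ∃ C : ℝ, 0 < C ∧
    ∀ (X p : ℕ), p.Prime → r + t < p → p ^ L ≤ X →
      (J ((t + 1) * r) (r + t) (X : ℝ) : ℝ) ≤ C * (X : ℝ) ^ ((t + 1) * r) * (X : ℝ) ^ Δ *
        ((p : ℝ) ^ (-Δ) + (p : ℝ) ^ (3 * ((t + 1) * r)) *
          (((p : ℝ) ^ (-Δ)) ^ E + (p : ℝ) ^ c * ((p : ℝ) ^ (-Δ)) ^ n)) := by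
  refine ⟨((t + 1) * E + 1) * (2 * (r * t) + 1), fun n => ?_⟩
  obtain ⟨L, hG⟩ := fwG_all hr1 hr ht E n ((t + 1) * E + 1) (by omega) ((t + 1) * E) 1 le_rfl
    (by omega)
  set c := ((t + 1) * E + 1) * (2 * (r * t) + 1) with hc
  set s0 := (t + 1) * r with hs0
  have hs1 : 1 ≤ s0 := by rw [hs0]; nlinarith
  obtain ⟨C0, hC0, hS⟩ := fw_S1 s0 1 hs1 le_rfl
  refine ⟨L + 1, fun Δ A hΔ hyp => ?_⟩
  obtain ⟨C1, hC1, hG⟩ := hG Δ A hΔ hyp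
  have hA := fwHyp_nonneg hyp
  set A' := (A + 1) * 2 ^ ((((t + 1) * r : ℕ) : ℝ) + Δ) with hA'
  have hA0 : 0 < A' := by positivity
  refine ⟨C0 * (A' + (s0 : ℝ) ^ 2 * C1), by positivity, ?_⟩
  intro X p hp hpk hX
  have hp1 := hp.one_lt.le
  have hp0 : (1 : ℝ) ≤ p := by exact_mod_cast hp1
  set M : ℕ := s0 * X ^ (r + t) + 1 with hM0
  haveI : NeZero M := ⟨by omega⟩
  have hM : s0 * X ^ (r + t) < M := by omega
  have hJ := fw_J_le (s := s0) (k := r + t) hM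
  have hIcc : Finset.Icc 1 (X : ℤ) = fwc X p 0 0 := by
    ext x; simp [fw_mem_fwc]
  obtain ⟨hw0, hw1⟩ := fw_w_mem hp1 hΔ
  have hnar : ∀ ζ : ℤ, (p : ℤ) ^ 0 ∣ ζ - 0 → fwX (fun α : Fin (r + t) → ZMod M =>
      (fun _ => (1 : ℝ)) α * ‖fwf (fwc X p (0 + 1) ζ) α‖ ^ (2 * (s0 * 1))) ≤
      A' * ((X : ℝ) / (p : ℝ) ^ 1) ^ (r * (t + 1)) * (X : ℝ) ^ Δ * ((p : ℝ) ^ (-Δ)) ^ 1 := by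
    intro ζ _
    refine le_trans (le_of_eq ?_) (fw_C2 hΔ hyp hp1 (fw_pow_le (a := 1) hp1 hX (by omega)) hM ζ
      (Fintype.piFinset fun _ : Fin r => fwc X p 1 ζ)
      (fun x hx i => by simpa using (Fintype.mem_piFinset.mp hx) i))
    congr 1; funext α
    rw [one_mul, ← fwf_pow]
    congr 1
    rw [hs0]; ring
  have key := hS (r + t) M X p 0 hp1 0 (fun _ => 1) (fun _ => zero_le_one) _ hnar
  have hg := hG M X p hp hpk (fw_pow_le hp1 hX (by omega)) hM
  set w := (p : ℝ) ^ (-Δ) with hw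
  set y := (X : ℝ) ^ Δ with hy
  have hy0 : 0 ≤ y := by positivity
  set P : ℝ := (p : ℝ) with hP
  set X1 : ℝ := (X : ℝ) / P ^ 1 with hX1
  have hX10 : 0 ≤ X1 := by positivity
  have hX1X : X1 ≤ X := by
    rw [hX1, pow_one]; exact div_le_self (by positivity) hp0
  set Z := w ^ E + P ^ c * w ^ n with hZ
  have hZ0 : 0 ≤ Z := by positivity
  have hXs : X1 ^ r * X1 ^ (r * t) ≤ (X : ℝ) ^ s0 := by
    rw [← pow_add]
    have : r + r * t = s0 := by rw [hs0]; ring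
    rw [this]; gcongr
  set G := (Fintype.piFinset (fun _ : Fin s0 => fwCl p 0 (0 + 1) 0)).filter
    (fun g => StrictMono g) with hGdef
  have hGcard : (G.card : ℝ) ≤ P ^ s0 := by
    have h1 : G.card ≤ p ^ s0 := by
      refine (Finset.card_filter_le _ _).trans ?_
      rw [Fintype.card_piFinset]
      simp only [Finset.prod_const, Finset.card_univ, Fintype.card_fin]
      gcongr
      have := fw_card_Cl hp1 (show 0 ≤ 0 + 1 by omega) 0
      simpa using this
    rw [hP]; exact_mod_cast h1
  set Q := (Finset.univ : Finset (Fin s0 × Fin s0)).filter (fun q => q.1 ≠ q.2) with hQ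
  have hQcard : (Q.card : ℝ) ≤ (s0 : ℝ) ^ 2 := by
    have h1 : Q.card ≤ s0 ^ 2 := by
      refine (Finset.card_filter_le _ _).trans ?_
      simp [sq]
    exact_mod_cast h1
  have hbroad : fwX (fun α : Fin (r + t) → ZMod M => (fun _ => (1 : ℝ)) α *
      ‖fwS (fwT s0 X p 0 0) α‖ ^ (2 * 1)) ≤
      (P ^ s0) ^ 2 * (P ^ s0 * ((s0 : ℝ) ^ 2 * (C1 * (X : ℝ) ^ s0 * y * Z))) := by
    calc _ ≤ fwX (fun α : Fin (r + t) → ZMod M => (P ^ s0) ^ 2 * ∑ g ∈ G, ∑ q ∈ Q,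
            (‖fwf (fwc X p 1 (g q.2)) α‖ ^ (2 * (r * t)) *
              ‖fwf (fwc X p 1 (g q.1)) α‖ ^ (2 * (r * 1)))) := by
          refine fwX_mono fun α => ?_
          rw [one_mul, fwS_T hp1 0 α]
          calc _ ≤ (∑ g ∈ G, ‖∏ i, fwf (fwc X p (0 + 1) (g i)) α‖) ^ (2 * 1) :=
                pow_le_pow_left₀ (norm_nonneg _) (norm_sum_le _ _) _
            _ ≤ _ := fw_powmean _ _ (fun _ _ => norm_nonneg _) _ (by norm_num)
            _ ≤ (P ^ s0) ^ 2 * ∑ g ∈ G, ‖∏ i, fwf (fwc X p (0 + 1) (g i)) α‖ ^ (2 * 1) := by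
                rw [mul_one]; gcongr
            _ ≤ _ := by
                gcongr with g hg
                rw [norm_prod, ← Finset.prod_pow, mul_one]
                exact fw_prod2 hr1 ht hs0 (fun i => ‖fwf (fwc X p 1 (g i)) α‖)
                  (fun i => norm_nonneg _)
      _ = (P ^ s0) ^ 2 * ∑ g ∈ G, ∑ q ∈ Q, fwX (fun α : Fin (r + t) → ZMod M =>
            (‖fwf (fwc X p 1 (g q.2)) α‖ ^ (2 * (r * t)) *
              ‖fwf (fwc X p 1 (g q.1)) α‖ ^ (2 * (r * 1)))) := by
          rw [fwX_mul, fwX_sum]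
          simp_rw [fwX_sum]
      _ ≤ (P ^ s0) ^ 2 * ∑ g ∈ G, ∑ q ∈ Q, (C1 * (X : ℝ) ^ s0 * y * Z) := by
          gcongr with g hgG q hq
          have hgm := (Finset.mem_filter.mp hgG)
          have hmem := fun i => (fw_mem_fwCl.mp (Fintype.mem_piFinset.mp hgm.1 i)).1
          have hne : g q.1 ≠ g q.2 := fun h => (Finset.mem_filter.mp hq).2 (hgm.2.injective h)
          refine (hg (g q.1) (g q.2) ?_).trans ?_
          · intro hd
            have a1 := hmem q.1
            have a2 := hmem q.2
            simp only [zero_add, pow_one] at a1 a2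
            have : |g q.1 - g q.2| < (p : ℤ) := by rw [abs_lt]; constructor <;> linarith
            have := Int.eq_zero_of_abs_lt_dvd hd this
            exact hne (by linarith)
          · rw [mul_assoc C1]; gcongr
      _ = (P ^ s0) ^ 2 * (G.card * (Q.card * (C1 * (X : ℝ) ^ s0 * y * Z))) := by
          simp [Finset.sum_const, nsmul_eq_mul]
      _ ≤ _ := by gcongr
  have hJ' : (J s0 (r + t) (X : ℝ) : ℝ) ≤ fwX (fun α : Fin (r + t) → ZMod M =>
      (fun _ => (1 : ℝ)) α * ‖fwf (fwc X p 0 0) α‖ ^ (2 * (s0 * 1))) := by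
    refine hJ.trans (le_of_eq ?_)
    congr 1; funext α
    rw [hIcc, one_mul, mul_one]
  have e5 : P ^ (s0 * 1) * X1 ^ (r * (t + 1)) = (X : ℝ) ^ s0 := by
    have : r * (t + 1) = s0 := by rw [hs0]; ring
    rw [this, mul_one, ← mul_pow, hX1]
    congr 1
    field_simp
  refine hJ'.trans (key.trans ?_)
  calc _ ≤ C0 * ((P ^ s0) ^ 2 * (P ^ s0 * ((s0 : ℝ) ^ 2 * (C1 * (X : ℝ) ^ s0 * y * Z))) +
        P ^ (s0 * 1) * (A' * X1 ^ (r * (t + 1)) * y * w ^ 1)) := by gcongr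
    _ = C0 * (((s0 : ℝ) ^ 2 * (C1 * (X : ℝ) ^ s0 * y * (P ^ (3 * s0) * Z))) +
        (A' * (P ^ (s0 * 1) * X1 ^ (r * (t + 1))) * y * w)) := by ring
    _ = (C0 * (X : ℝ) ^ s0 * y) * ((s0 : ℝ) ^ 2 * C1 * (P ^ (3 * s0) * Z) + A' * w) := by
        rw [e5]; ring
    _ ≤ (C0 * (X : ℝ) ^ s0 * y) * ((A' + (s0 : ℝ) ^ 2 * C1) * (w + P ^ (3 * s0) * Z)) := by
        gcongr
        have h1 : 0 ≤ A' * (P ^ (3 * s0) * Z) := by positivity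
        have h2 : 0 ≤ (s0 : ℝ) ^ 2 * C1 * w := by positivity
        nlinarith
    _ = _ := by ring


lemma fw_J_triv (s k N : ℕ) : J s k (N : ℝ) ≤ N ^ (2 * s) := by
  classical
  let F : Finset ((Fin s → ℤ) × (Fin s → ℤ)) :=
    (Fintype.piFinset fun _ => Finset.Icc (1 : ℤ) N) ×ˢ
      (Fintype.piFinset fun _ => Finset.Icc (1 : ℤ) N)
  have hF : F.card = N ^ (2 * s) := by
    simp [F, Finset.card_product, two_mul, pow_add]
  rw [← hF, ← Set.ncard_coe_finset F]
  unfold J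
  refine Set.ncard_le_ncard ?_ (Finset.finite_toSet _)
  rintro ⟨x, y⟩ ⟨h1, h2, -⟩
  simp only [F, Finset.coe_product, Set.mem_prod, Finset.mem_coe, Fintype.mem_piFinset,
    Finset.mem_Icc]
  exact ⟨fun i => ⟨(h1 i).1, by exact_mod_cast (h1 i).2⟩,
    fun i => ⟨(h2 i).1, by exact_mod_cast (h2 i).2⟩⟩

lemma fw_J_succ (s k N : ℕ) : N * J s k (N : ℝ) ≤ J (s + 1) k (N : ℝ) := by
  have hN : N = (Set.Icc (1 : ℤ) N).ncard := by
    rw [← Finset.coe_Icc, Set.ncard_coe_finset]; simp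
  have hfin := fw_J_finite (s + 1) k N
  unfold J
  conv_lhs => arg 1; rw [hN]
  rw [← Set.ncard_prod]
  refine Set.ncard_le_ncard_of_injOn
    (fun q : ℤ × ((Fin s → ℤ) × (Fin s → ℤ)) =>
      ((Fin.cons q.1 q.2.1 : Fin (s + 1) → ℤ), (Fin.cons q.1 q.2.2 : Fin (s + 1) → ℤ))) ?_ ?_ hfin
  · rintro ⟨z, x, y⟩ ⟨hz, h1, h2, h3⟩
    simp only [Set.mem_Icc] at hz
    have hz2 : (z : ℝ) ≤ (N : ℝ) := by exact_mod_cast hz.2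
    refine ⟨fun i => ?_, fun i => ?_, fun j hj => ?_⟩
    · refine Fin.cases ?_ (fun i => ?_) i
      · simpa using ⟨hz.1, hz2⟩
      · simpa using h1 i
    · refine Fin.cases ?_ (fun i => ?_) i
      · simpa using ⟨hz.1, hz2⟩
      · simpa using h2 i
    · simp only [Fin.sum_univ_succ, Fin.cons_zero, Fin.cons_succ]
      rw [h3 j hj]
  · rintro ⟨z, x, y⟩ - ⟨z', x', y'⟩ - h
    simp only [Prod.mk.injEq, Fin.cons_inj] at h
    simp [h.1.1, h.1.2, h.2.2]

lemma fw_J_add (s d k N : ℕ) : N ^ d * J s k (N : ℝ) ≤ J (s + d) k (N : ℝ) := by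
  induction d with
  | zero => simp
  | succ d ih =>
    calc _ = N * (N ^ d * J s k (N : ℝ)) := by ring
      _ ≤ N * J (s + d) k (N : ℝ) := Nat.mul_le_mul_left _ ih
      _ ≤ _ := fw_J_succ _ _ _

lemma fw_J_floor (s k : ℕ) (X : ℝ) (hX : 1 ≤ X) : J s k X = J s k ((⌊X⌋₊ : ℕ) : ℝ) := by
  unfold J
  congr 1
  ext q
  have : ∀ z : ℤ, 1 ≤ z → ((z : ℝ) ≤ X ↔ (z : ℝ) ≤ ((⌊X⌋₊ : ℕ) : ℝ)) := by
    intro z hz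
    obtain ⟨m, rfl⟩ := Int.eq_ofNat_of_zero_le (show 0 ≤ z by omega)
    simp only [Int.cast_natCast, Nat.cast_le]
    exact (Nat.le_floor_iff (by linarith)).symm
  simp only [Set.mem_ofPred_eq]
  refine and_congr (forall_congr' fun i => and_congr_right fun h => this _ h)
    (and_congr_left fun _ => forall_congr' fun i => and_congr_right fun h => this _ h)

lemma fw_root (L X : ℕ) (hL : 1 ≤ L) (hX : 1 ≤ X) : ∃ m : ℕ, m ^ L ≤ X ∧ X < (m + 1) ^ L := by
  have h : ∃ m : ℕ, X < (m + 1) ^ L := ⟨X, by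
    calc X < X + 1 := by omega
      _ ≤ (X + 1) ^ L := Nat.le_self_pow (by omega) _⟩
  refine ⟨Nat.find h, ?_, Nat.find_spec h⟩
  rcases Nat.eq_zero_or_pos (Nat.find h) with h0 | h0
  · rw [h0, zero_pow (by omega)]; omega
  · have := Nat.find_min h (m := Nat.find h - 1) (by omega)
    rw [Nat.sub_add_cancel h0] at this
    omega

lemma fw_prime (L B X : ℕ) (hL : 1 ≤ L) (hB : 1 ≤ B) (hX : (2 * B) ^ L ≤ X) :
    ∃ p : ℕ, p.Prime ∧ B < p ∧ p ^ L ≤ X ∧ X ≤ (2 * p) ^ L := by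
  have hX1 : 1 ≤ X := le_trans (Nat.one_le_pow _ _ (by omega)) hX
  obtain ⟨m, h1, h2⟩ := fw_root L X hL hX1
  have hm : 2 * B < m + 1 := lt_of_pow_lt_pow_left₀ L (by omega) (lt_of_le_of_lt hX h2)
  obtain ⟨p, hp, h3, h4⟩ := Nat.exists_prime_lt_and_le_two_mul (m / 2) (by omega)
  refine ⟨p, hp, by omega, ?_, ?_⟩
  · exact (Nat.pow_le_pow_left (by omega) L).trans h1
  · exact h2.le.trans (Nat.pow_le_pow_left (by omega) L)

lemma fwHyp_mono {r t : ℕ} {Δ Δ' A : ℝ} (h : Δ ≤ Δ') (hyp : fwHyp r t Δ A) : fwHyp r t Δ' A := by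
  intro N hN
  have hA := fwHyp_nonneg hyp
  refine (hyp N hN).trans ?_
  have : (1 : ℝ) ≤ N := by exact_mod_cast hN
  gcongr

lemma fw_improve {r t : ℕ} (hr1 : 1 ≤ r) (hr : r ≤ t + 1) (ht : 1 ≤ t) {Δ0 : ℝ} (hΔ0 : 0 < Δ0) :
    ∃ δ : ℝ, 0 < δ ∧ ∀ Δ, Δ0 ≤ Δ → (∃ A, fwHyp r t Δ A) → ∃ A, fwHyp r t (Δ - δ) A := by
  obtain ⟨E, hE⟩ := exists_nat_ge ((((3 * ((t + 1) * r) : ℕ) : ℝ) + Δ0) / Δ0)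
  obtain ⟨c, hc⟩ := fw_main hr1 hr ht E
  obtain ⟨n, hn⟩ := exists_nat_ge ((((3 * ((t + 1) * r) : ℕ) : ℝ) + c + Δ0) / Δ0)
  obtain ⟨L, hL⟩ := hc n
  rw [div_le_iff₀ hΔ0] at hE hn
  have hL0 : (0 : ℝ) < ((L + 1 : ℕ) : ℝ) := by positivity
  refine ⟨Δ0 / ((L + 1 : ℕ) : ℝ), by positivity, ?_⟩
  rintro Δ hΔ ⟨A, hyp⟩
  set δ := Δ0 / ((L + 1 : ℕ) : ℝ) with hδ
  have hδL : ((L + 1 : ℕ) : ℝ) * δ = Δ0 := by rw [hδ]; field_simp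
  have hδ0 : 0 < δ := by positivity
  have hδΔ : δ ≤ Δ0 := by
    rw [hδ]; exact div_le_self hΔ0.le (by exact_mod_cast Nat.succ_le_succ (Nat.zero_le L))
  have hΔ' : 0 ≤ Δ := by linarith
  obtain ⟨C, hC, hJ⟩ := hL Δ A hΔ' hyp
  set s0 := (t + 1) * r with hs0
  set X0 : ℕ := (2 * (r + t)) ^ (L + 1) with hX0
  refine ⟨3 * C * 2 ^ Δ0 + (X0 : ℝ) ^ (2 * s0), ?_⟩
  intro X hX
  have hX1 : (1 : ℝ) ≤ X := by exact_mod_cast hX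
  change (J s0 (r + t) (X : ℝ) : ℝ) ≤ _ * (X : ℝ) ^ ((s0 : ℝ) + (Δ - δ))
  rw [add_mul (3 * C * 2 ^ Δ0)]
  have hpos : 0 ≤ 3 * C * 2 ^ Δ0 * (X : ℝ) ^ ((s0 : ℝ) + (Δ - δ)) := by positivity
  have hpos2 : 0 ≤ (X0 : ℝ) ^ (2 * s0) * (X : ℝ) ^ ((s0 : ℝ) + (Δ - δ)) := by positivity
  rcases le_total X X0 with hsm | hbig
  · have h1 : (J s0 (r + t) (X : ℝ) : ℝ) ≤ (X : ℝ) ^ (2 * s0) := by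
      exact_mod_cast fw_J_triv s0 (r + t) X
    have h2 : (X : ℝ) ^ (2 * s0) ≤ (X0 : ℝ) ^ (2 * s0) := by gcongr
    have h3 : (1 : ℝ) ≤ (X : ℝ) ^ ((s0 : ℝ) + (Δ - δ)) :=
      Real.one_le_rpow hX1 (by have : (0 : ℝ) ≤ s0 := by positivity
                               linarith)
    have h4 : (X0 : ℝ) ^ (2 * s0) ≤ (X0 : ℝ) ^ (2 * s0) * (X : ℝ) ^ ((s0 : ℝ) + (Δ - δ)) :=
      le_mul_of_one_le_right (by positivity) h3
    linarith
  · obtain ⟨p, hp, hpB, hpX, hXp⟩ := fw_prime (L + 1) (r + t) X (by omega) (by omega) hbig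
    have hp1 : (1 : ℝ) ≤ p := by exact_mod_cast hp.one_lt.le
    have hp0 : (0 : ℝ) < p := by linarith
    have h1 := hJ X p hp hpB (fw_pow_le hp.one_lt.le hpX (by omega))
    have hb1 : (p : ℝ) ^ (-Δ) ≤ (p : ℝ) ^ (-Δ0) := Real.rpow_le_rpow_of_exponent_le hp1 (by linarith)
    have hpw : ∀ m : ℕ, ((p : ℝ) ^ (-Δ)) ^ m ≤ (p : ℝ) ^ (-(m * Δ0)) := by
      intro m
      calc _ ≤ ((p : ℝ) ^ (-Δ0)) ^ m := by gcongr
        _ = _ := by rw [← Real.rpow_natCast, ← Real.rpow_mul hp0.le]; congr 1; ring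
    have hb2 : (p : ℝ) ^ (3 * s0) * ((p : ℝ) ^ (-Δ)) ^ E ≤ (p : ℝ) ^ (-Δ0) := by
      calc _ ≤ (p : ℝ) ^ (((3 * s0 : ℕ) : ℝ)) * (p : ℝ) ^ (-(E * Δ0)) := by
            rw [Real.rpow_natCast]; gcongr; exact hpw E
        _ = (p : ℝ) ^ ((((3 * s0 : ℕ) : ℝ)) + -(E * Δ0)) := (Real.rpow_add hp0 _ _).symm
        _ ≤ _ := Real.rpow_le_rpow_of_exponent_le hp1 (by linarith)
    have hb3 : (p : ℝ) ^ (3 * s0) * ((p : ℝ) ^ c * ((p : ℝ) ^ (-Δ)) ^ n) ≤ (p : ℝ) ^ (-Δ0) := by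
      calc _ ≤ (p : ℝ) ^ (((3 * s0 : ℕ) : ℝ)) * ((p : ℝ) ^ ((c : ℕ) : ℝ) * (p : ℝ) ^ (-(n * Δ0))) := by
            rw [Real.rpow_natCast, Real.rpow_natCast]; gcongr; exact hpw n
        _ = (p : ℝ) ^ ((((3 * s0 : ℕ) : ℝ)) + ((c : ℝ) + -(n * Δ0))) := by
            rw [Real.rpow_add hp0, Real.rpow_add hp0]
        _ ≤ _ := Real.rpow_le_rpow_of_exponent_le hp1 (by linarith)
    have hb4 : (p : ℝ) ^ (-Δ0) ≤ 2 ^ Δ0 * (X : ℝ) ^ (-δ) := by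
      have hXp' : (X : ℝ) ≤ (2 * (p : ℝ)) ^ (L + 1) := by exact_mod_cast hXp
      have e1 : (X : ℝ) ^ δ ≤ (2 * (p : ℝ)) ^ Δ0 := by
        calc _ ≤ ((2 * (p : ℝ)) ^ (L + 1)) ^ δ := by gcongr
          _ = _ := by rw [← Real.rpow_natCast, ← Real.rpow_mul (by positivity), hδL]
      rw [Real.mul_rpow (by norm_num) hp0.le] at e1
      rw [Real.rpow_neg hp0.le, Real.rpow_neg (by positivity), ← div_eq_mul_inv,
        le_div_iff₀ (by positivity), inv_mul_le_iff₀ (by positivity)]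
      linarith
    refine h1.trans (le_trans ?_ (le_add_of_nonneg_right hpos2))
    calc _ ≤ C * (X : ℝ) ^ s0 * (X : ℝ) ^ Δ * (3 * (2 ^ Δ0 * (X : ℝ) ^ (-δ))) := by
          gcongr
          rw [mul_add]
          linarith
      _ = 3 * C * 2 ^ Δ0 * ((X : ℝ) ^ ((s0 : ℕ) : ℝ) * ((X : ℝ) ^ Δ * (X : ℝ) ^ (-δ))) := by
          rw [Real.rpow_natCast]; ring
      _ = _ := by
          rw [← Real.rpow_add (by linarith), ← Real.rpow_add (by linarith), sub_eq_add_neg]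

lemma fw_final {r t : ℕ} (hr1 : 1 ≤ r) (hr : r ≤ t + 1) (ht : 1 ≤ t) {ε : ℝ} (hε : 0 < ε) :
    ∃ A, fwHyp r t ε A := by
  obtain ⟨δ, hδ, h⟩ := fw_improve hr1 hr ht hε
  have key : ∀ j : ℕ, ∃ A, fwHyp r t (max ε ((((t + 1) * r : ℕ) : ℝ) - j * δ)) A := by
    intro j
    induction j with
    | zero =>
      refine ⟨1, fwHyp_mono (Δ := (((t + 1) * r : ℕ) : ℝ)) (by simp) ?_⟩
      intro N hN
      rw [one_mul, ← two_mul]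
      have := fw_J_triv ((t + 1) * r) (r + t) N
      have e : (2 * (((t + 1) * r : ℕ) : ℝ)) = ((2 * ((t + 1) * r) : ℕ) : ℝ) := by push_cast; ring
      rw [e, Real.rpow_natCast]
      exact_mod_cast this
    | succ j ih =>
      obtain ⟨A, hA⟩ := h _ (le_max_left _ _) ih
      refine ⟨A, fwHyp_mono ?_ hA⟩
      have h1 := le_max_left ε ((((t + 1) * r : ℕ) : ℝ) - ((j + 1 : ℕ) : ℝ) * δ)
      have h2 := le_max_right ε ((((t + 1) * r : ℕ) : ℝ) - ((j + 1 : ℕ) : ℝ) * δ)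
      rw [sub_le_iff_le_add, max_le_iff]
      refine ⟨by linarith, ?_⟩
      push_cast at h2 ⊢
      linarith
  obtain ⟨j, hj⟩ := exists_nat_ge ((((t + 1) * r : ℕ) : ℝ) / δ)
  rw [div_le_iff₀ hδ] at hj
  obtain ⟨A, hA⟩ := key j
  exact ⟨A, by rwa [max_eq_left (by linarith)] at hA⟩

theorem ford_wooley_small_s (k s : ℕ) (hk : 2 ≤ k) (hs : 1 ≤ s)
    (hsk : (s : ℝ) ≤ ((k : ℝ) + 1) ^ 2 / 4) (ε : ℝ) (hε : ε > 0) :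
    ∃ C : ℝ, ∀ X : ℝ, X ≥ 1 → (J s k X : ℝ) ≤ C * X ^ ((s : ℝ) + ε) := by
  have hs4 : 4 * s ≤ (k + 1) ^ 2 := by
    have : (4 : ℝ) * s ≤ ((k : ℝ) + 1) ^ 2 := by linarith
    exact_mod_cast this
  obtain ⟨r, t, hr1, hr, ht, hkrt, hss⟩ : ∃ r t : ℕ, 1 ≤ r ∧ r ≤ t + 1 ∧ 1 ≤ t ∧ k = r + t ∧
      s ≤ (t + 1) * r := by
    rcases Nat.even_or_odd' k with ⟨m, rfl | rfl⟩
    · refine ⟨m, m, by omega, by omega, by omega, by omega, ?_⟩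
      by_contra hcon
      have : (m + 1) * m + 1 ≤ s := by omega
      nlinarith
    · refine ⟨m + 1, m, by omega, by omega, by omega, by omega, ?_⟩
      nlinarith
  subst hkrt
  obtain ⟨A, hA⟩ := fw_final hr1 hr ht hε
  have hA0 := fwHyp_nonneg hA
  obtain ⟨d, hd⟩ := Nat.exists_eq_add_of_le hss
  refine ⟨A, fun X hX => ?_⟩
  rw [fw_J_floor s _ X hX]
  set N := ⌊X⌋₊ with hN
  have hN1 : 1 ≤ N := Nat.one_le_floor_iff X |>.mpr hX
  have hN1' : (1 : ℝ) ≤ N := by exact_mod_cast hN1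
  have hNX : (N : ℝ) ≤ X := Nat.floor_le (by linarith)
  have h1 := hA N hN1
  rw [hd] at h1
  have h2 : (N : ℝ) ^ d * (J s (r + t) (N : ℝ) : ℝ) ≤ J (s + d) (r + t) (N : ℝ) := by
    exact_mod_cast fw_J_add s d (r + t) N
  have h3 : (N : ℝ) ^ (((s + d : ℕ) : ℝ) + ε) = (N : ℝ) ^ d * (N : ℝ) ^ ((s : ℝ) + ε) := by
    rw [← Real.rpow_natCast (N : ℝ) d, ← Real.rpow_add (by linarith)]
    congr 1; push_cast; ring
  have h4 : (J s (r + t) (N : ℝ) : ℝ) ≤ A * (N : ℝ) ^ ((s : ℝ) + ε) := by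
    have hpos : (0 : ℝ) < (N : ℝ) ^ d := by positivity
    refine le_of_mul_le_mul_left ?_ hpos
    calc _ ≤ _ := h2
      _ ≤ _ := h1
      _ = _ := by rw [h3]; ring
  refine h4.trans ?_
  gcongr
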